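/- arXiv:2204.09587 — 2 statements merged into one kernel-verified Lean document; each statement's English description precedes it below -/
import Mathlib

section
/- Let θ₀ = 1 < θ₁ and let c ∈ ℝ be a given constant. There exists ε₀ > 0 such that for every ε ∈ (0, ε₀) there exist a constant P₀ > 0 and smooth positive functions ρ, θ on [0,1] satisfying: (i) ρ(x) θ(x) = P₀ for all x; (ii) d/dx(θ^{1/2} θ') = 0 on (0,1); (iii) the slip boundary conditions (θ(0) − 1)/θ(0) = (c/P₀) ε θ'(0) and (θ(1) − θ₁)/θ(1) = −(c/P₀) ε θ'(1); (iv) the normalization ∫₀¹ ρ(x) dx = 1; and (v) for every k ∈ ℕ there is a constant C_k > 0 independent of ε such that Σ_{i=0}^{k} sup_{x ∈ [0,1]} (|d^i/dx^i (ρ(x) − 1)| + |d^i/dx^i (θ(x) − 1)|) ≤ C_k (θ₁ − 1). Moreover this solution is unique in the following sense: there is a neighborhood U of (θ₁^{3/2} − 1, 1, (θ₁^{3/2} − 1)/(3(θ₁^{1/2} − 1))) in ℝ³, independent of ε, such that exactly one triple (D₁, D₂, P₀) ∈ U gives a solution of (i)–(iv) via θ(x) = (D₁ x + D₂)^{2/3},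 ρ = P₀/θ. -/
open Real Set

/-- The steady compressible Navier–Stokes heat-transfer system on `[0,1]` with
temperature-jump (slip) boundary conditions and unit total mass:
(i) `ρθ ≡ P₀`; (ii) `(θ^{1/2} θ')' = 0` on `(0,1)`;
(iii) `(θ(0)−1)/θ(0) = (c/P₀) ε θ'(0)`, `(θ(1)−θ₁)/θ(1) = −(c/P₀) ε θ'(1)`;
(iv) `∫₀¹ ρ = 1`. -/
noncomputable def IsNSSol (c θ₁ ε P₀ : ℝ) (ρ θ : ℝ → ℝ) : Prop :=
  (∀ x ∈ Icc (0:ℝ) 1, ρ x * θ x = P₀) ∧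
  (∀ x ∈ Ioo (0:ℝ) 1, deriv (fun y => Real.sqrt (θ y) * deriv θ y) x = 0) ∧
  (θ 0 - 1) / θ 0 = (c / P₀) * ε * deriv θ 0 ∧
  (θ 1 - θ₁) / θ 1 = -(c / P₀) * ε * deriv θ 1 ∧
  (∫ x in (0:ℝ)..1, ρ x) = 1

lemma ns_alg_exists (θ₁ s : ℝ) (hθ : 1 < θ₁) (hs : |s| * (16 * (1 + θ₁)) ≤ 1) :
    ∃ a b : ℝ, 9 / 10 ≤ a ∧ a < b ∧ b ≤ 2 * θ₁ ∧
      (1 + s) * a ^ 2 - s * (a * b) = 1 ∧ (1 + s) * b ^ 2 - s * (a * b) = θ₁ := by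
  obtain ⟨hs1, hs2⟩ : -(1 / (16 * (1 + θ₁))) ≤ s ∧ s ≤ 1 / (16 * (1 + θ₁)) := by
    rw [← abs_le, le_div_iff₀ (by positivity)]; exact hs
  have hsB1 : -(1 / 16) ≤ s * (1 + θ₁) := by
    have := mul_le_mul_of_nonneg_right hs1 (show 0 ≤ 1 + θ₁ by linarith)
    have h2 : -(1 / (16 * (1 + θ₁))) * (1 + θ₁) = -(1 / 16) := by
      have : 1 + θ₁ ≠ 0 := by linarith
      field_simp
    linarith
  have hsB2 : s * (1 + θ₁) ≤ 1 / 16 := by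
    have := mul_le_mul_of_nonneg_right hs2 (show 0 ≤ 1 + θ₁ by linarith)
    have h2 : (1 / (16 * (1 + θ₁))) * (1 + θ₁) = (1 / 16) := by
      have : 1 + θ₁ ≠ 0 := by linarith
      field_simp
    linarith
  have hs3 : s ≤ 1 / 32 := by nlinarith
  have hs4 : -(1 / 32) ≤ s := by nlinarith
  obtain ⟨m, hm, hmq⟩ : ∃ m : ℝ, 0 < m ∧ m ^ 2 * (1 + 2 * s) - s * (1 + θ₁) * m - θ₁ = 0 := by
    have hD : 0 ≤ (s * (1 + θ₁)) ^ 2 + 4 * θ₁ * (1 + 2 * s) := by nlinarith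
    have hr := Real.sq_sqrt hD
    have hr0 := Real.sqrt_nonneg ((s * (1 + θ₁)) ^ 2 + 4 * θ₁ * (1 + 2 * s))
    set r := √((s * (1 + θ₁)) ^ 2 + 4 * θ₁ * (1 + 2 * s))
    have hA : 0 < 1 + 2 * s := by linarith
    refine ⟨(s * (1 + θ₁) + r) / (2 * (1 + 2 * s)), ?_, ?_⟩
    · apply div_pos _ (by linarith)
      nlinarith
    · have hmr : (s * (1 + θ₁) + r) / (2 * (1 + 2 * s)) * (2 * (1 + 2 * s)) = s * (1 + θ₁) + r :=
        div_mul_cancel₀ _ (by linarith)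
      set m := (s * (1 + θ₁) + r) / (2 * (1 + 2 * s))
      have hr2 : r = m * (2 * (1 + 2 * s)) - s * (1 + θ₁) := by linarith
      rw [hr2] at hr
      have h4 : 4 * (1 + 2 * s) ≠ 0 := by linarith
      apply mul_left_cancel₀ h4
      linear_combination hr
  have hmK : m ≤ 2 * (1 + θ₁) := by
    by_contra hcon
    push Not at hcon
    nlinarith
  have hsm1 : -(1 / 8) ≤ s * m := by
    rcases le_total 0 s with h | h
    · nlinarith
    · nlinarith
  have hsm2 : s * m ≤ 1 / 8 := by
    rcases le_total 0 s with h | h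
    · nlinarith
    · nlinarith
  have h1s : 0 < 1 + s := by linarith
  have ha0 : 0 < (1 + s * m) / (1 + s) := div_pos (by linarith) h1s
  have hb0 : 0 < (θ₁ + s * m) / (1 + s) := div_pos (by linarith) h1s
  have hab : √((1 + s * m) / (1 + s)) * √((θ₁ + s * m) / (1 + s)) = m := by
    rw [← Real.sqrt_mul ha0.le, show (1 + s * m) / (1 + s) * ((θ₁ + s * m) / (1 + s)) = m ^ 2 by
      have := h1s.ne'
      field_simp
      nlinarith, Real.sqrt_sq hm.le]
  refine ⟨√((1 + s * m) / (1 + s)), √((θ₁ + s * m) / (1 + s)), ?_, ?_, ?_, ?_, ?_⟩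
  · apply Real.le_sqrt_of_sq_le
    rw [le_div_iff₀ h1s]; linarith
  · apply Real.sqrt_lt_sqrt ha0.le
    gcongr
  · apply Real.sqrt_le_iff.2 ⟨by linarith, ?_⟩
    rw [div_le_iff₀ h1s]; nlinarith
  · rw [hab, Real.sq_sqrt ha0.le]
    have := h1s.ne'
    field_simp
    ring
  · rw [hab, Real.sq_sqrt hb0.le]
    have := h1s.ne'
    field_simp
    ring

lemma ns_alg_unique (θ₁ s a b a' b' : ℝ) (hθ : 1 < θ₁) (hs : |s| * (16 * (1 + θ₁)) ≤ 1)
    (ha : 0 < a) (hb : 0 < b) (ha' : 0 < a') (hb' : 0 < b')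
    (h1 : (1 + s) * a ^ 2 - s * (a * b) = 1) (h2 : (1 + s) * b ^ 2 - s * (a * b) = θ₁)
    (h1' : (1 + s) * a' ^ 2 - s * (a' * b') = 1)
    (h2' : (1 + s) * b' ^ 2 - s * (a' * b') = θ₁) : a = a' ∧ b = b' := by
  have hs3 : -(1 / 32) ≤ s := by
    have : |s| ≤ 1 / 32 := by nlinarith [abs_nonneg s]
    exact (abs_le.1 this).1
  have key : ∀ x y : ℝ, (1 + s) * x ^ 2 - s * (x * y) = 1 → (1 + s) * y ^ 2 - s * (x * y) = θ₁ →
      (x * y) ^ 2 * (1 + 2 * s) - s * (1 + θ₁) * (x * y) - θ₁ = 0 := by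
    intro x y e1 e2
    have e3 : ((1 + s) * x ^ 2) * ((1 + s) * y ^ 2) = (1 + s * (x * y)) * (θ₁ + s * (x * y)) := by
      rw [show (1 + s) * x ^ 2 = 1 + s * (x * y) by linarith,
        show (1 + s) * y ^ 2 = θ₁ + s * (x * y) by linarith]
    linear_combination e3
  have k1 := key a b h1 h2
  have k2 := key a' b' h1' h2'
  have hm : 0 < a * b := by positivity
  have hm' : 0 < a' * b' := by positivity
  have hmm : a * b = a' * b' := by
    have h3 : (a * b - a' * b') * ((1 + 2 * s) * (a * b) * (a' * b') + θ₁) = 0 := by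
      linear_combination (a' * b') * k1 - (a * b) * k2
    rcases mul_eq_zero.1 h3 with h | h
    · linarith
    · have h5 : 0 < (1 + 2 * s) * (a * b) * (a' * b') :=
        mul_pos (mul_pos (by linarith) hm) hm'
      linarith
  rw [hmm] at h1 h2
  have h1s : (1 + s) ≠ 0 := by linarith
  constructor
  · have : a ^ 2 = a' ^ 2 := mul_left_cancel₀ h1s (by linarith)
    exact (sq_eq_sq₀ ha.le ha'.le).1 this
  · have : b ^ 2 = b' ^ 2 := mul_left_cancel₀ h1s (by linarith)
    exact (sq_eq_sq₀ hb.le hb'.le).1 this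

lemma ns_hasDeriv (D₁ D₂ p x : ℝ) (h : 0 < D₁ * x + D₂) :
    HasDerivAt (fun y => (D₁ * y + D₂) ^ p) (D₁ * p * (D₁ * x + D₂) ^ (p - 1)) x := by
  have h1 : HasDerivAt (fun y : ℝ => D₁ * y + D₂) D₁ x := by
    simpa using ((hasDerivAt_id x).const_mul D₁).add_const D₂
  exact h1.rpow_const (Or.inl h.ne')

lemma ns_cube_rpow (a : ℝ) (ha : 0 < a) (p q : ℝ) (h : 3 * p = q) : (a ^ 3) ^ p = a ^ q := by
  rw [← Real.rpow_natCast a 3, ← Real.rpow_mul ha.le, ← h]; norm_num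

lemma ns_key (c θ₁ ε P a b : ℝ) (ha : 0 < a) (hab : a < b) (hP : 0 < P) :
    IsNSSol c θ₁ ε P (fun x => P / ((b ^ 3 - a ^ 3) * x + a ^ 3) ^ ((2:ℝ)/3))
      (fun x => ((b ^ 3 - a ^ 3) * x + a ^ 3) ^ ((2:ℝ)/3)) ↔
    (P = (a ^ 2 + a * b + b ^ 2) / 3 ∧
      (1 + 2 * c * ε) * a ^ 2 - 2 * c * ε * (a * b) = 1 ∧
      (1 + 2 * c * ε) * b ^ 2 - 2 * c * ε * (a * b) = θ₁) := by
  have hb : 0 < b := ha.trans hab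
  have hD : 0 < b ^ 3 - a ^ 3 := by
    have := pow_lt_pow_left₀ hab ha.le (n := 3) (by norm_num)
    linarith
  have ha3 : 0 < a ^ 3 := by positivity
  have hpos : ∀ x : ℝ, 0 ≤ x → 0 < (b ^ 3 - a ^ 3) * x + a ^ 3 := fun x hx => by
    have := mul_nonneg hD.le hx
    linarith
  have hone : (b ^ 3 - a ^ 3) * 1 + a ^ 3 = b ^ 3 := by ring
  have hzero : (b ^ 3 - a ^ 3) * 0 + a ^ 3 = a ^ 3 := by ring
  have c2 : ∀ t : ℝ, 0 < t → (t ^ 3) ^ ((2:ℝ)/3) = t ^ 2 := fun t ht => by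
    rw [ns_cube_rpow t ht _ 2 (by norm_num)]; norm_cast
  have c1 : ∀ t : ℝ, 0 < t → (t ^ 3) ^ ((1:ℝ)/3) = t := fun t ht => by
    rw [ns_cube_rpow t ht _ 1 (by norm_num)]; simp
  have cm : ∀ t : ℝ, 0 < t → (t ^ 3) ^ ((2:ℝ)/3 - 1) = t⁻¹ := fun t ht => by
    rw [ns_cube_rpow t ht _ (-1) (by norm_num), Real.rpow_neg_one]
  have d0 := (ns_hasDeriv (b ^ 3 - a ^ 3) (a ^ 3) (2/3) 0 (hpos 0 le_rfl)).deriv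
  have d1 := (ns_hasDeriv (b ^ 3 - a ^ 3) (a ^ 3) (2/3) 1 (hpos 1 zero_le_one)).deriv
  rw [hzero, cm a ha] at d0
  rw [hone, cm b hb] at d1
  have hint : (∫ x in (0:ℝ)..1, P / ((b ^ 3 - a ^ 3) * x + a ^ 3) ^ ((2:ℝ)/3))
      = P * 3 / (b ^ 3 - a ^ 3) * b - P * 3 / (b ^ 3 - a ^ 3) * a := by
    have := intervalIntegral.integral_eq_sub_of_hasDerivAt (a := 0) (b := 1)
      (f := fun x => P * 3 / (b ^ 3 - a ^ 3) * ((b ^ 3 - a ^ 3) * x + a ^ 3) ^ ((1:ℝ)/3))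
      (f' := fun x => P / ((b ^ 3 - a ^ 3) * x + a ^ 3) ^ ((2:ℝ)/3)) ?_ ?_
    · rw [this]
      simp only [hone, hzero, c1 a ha, c1 b hb]
    · intro x hx
      rw [uIcc_of_le zero_le_one] at hx
      have hx0 := hpos x hx.1
      refine ((ns_hasDeriv (b ^ 3 - a ^ 3) (a ^ 3) (1/3) x hx0).const_mul
        (P * 3 / (b ^ 3 - a ^ 3))).congr_deriv ?_
      rw [show (1:ℝ)/3 - 1 = -(2/3) by norm_num, Real.rpow_neg hx0.le]
      have := hD.ne'
      field_simp
    · apply ContinuousOn.intervalIntegrable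
      rw [uIcc_of_le zero_le_one]
      apply ContinuousOn.div continuousOn_const
      · apply ContinuousOn.rpow_const (by fun_prop)
        intro x hx
        exact Or.inl (hpos x hx.1).ne'
      · intro x hx
        exact (Real.rpow_pos_of_pos (hpos x hx.1) _).ne'
  have hq : b ^ 3 - a ^ 3 = (b - a) * (a ^ 2 + a * b + b ^ 2) := by ring
  have hq0 : 0 < a ^ 2 + a * b + b ^ 2 := by positivity
  have hba : 0 < b - a := by linarith
  have hmass : P * 3 / (b ^ 3 - a ^ 3) * b - P * 3 / (b ^ 3 - a ^ 3) * a = 1 ↔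
      P = (a ^ 2 + a * b + b ^ 2) / 3 := by
    have e : P * 3 / (b ^ 3 - a ^ 3) * b - P * 3 / (b ^ 3 - a ^ 3) * a
        = P * 3 / (a ^ 2 + a * b + b ^ 2) := by
      rw [hq]
      have := hba.ne'
      have := hq0.ne'
      field_simp
    rw [e, div_eq_iff hq0.ne', eq_div_iff (by norm_num), one_mul]
  have hbc : P = (a ^ 2 + a * b + b ^ 2) / 3 →
      (((a ^ 2 - 1) / a ^ 2 = (c / P) * ε * ((b ^ 3 - a ^ 3) * (2/3) * a⁻¹) ↔
        (1 + 2 * c * ε) * a ^ 2 - 2 * c * ε * (a * b) = 1) ∧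
      ((b ^ 2 - θ₁) / b ^ 2 = -(c / P) * ε * ((b ^ 3 - a ^ 3) * (2/3) * b⁻¹) ↔
        (1 + 2 * c * ε) * b ^ 2 - 2 * c * ε * (a * b) = θ₁)) := by
    intro hPe
    have hDP : (b ^ 3 - a ^ 3) = 3 * P * (b - a) := by rw [hPe]; ring
    rw [hDP]
    have e1 : (c / P) * ε * (3 * P * (b - a) * (2/3) * a⁻¹) = 2 * c * ε * (b - a) * a / a ^ 2 := by
      field_simp
    have e2 : -(c / P) * ε * (3 * P * (b - a) * (2/3) * b⁻¹)
        = -(2 * c * ε * (b - a) * b) / b ^ 2 := by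
      field_simp
    rw [e1, e2, div_left_inj' (by positivity), div_left_inj' (by positivity)]
    constructor <;> constructor <;> intro h <;> linarith
  unfold IsNSSol
  rw [hint, hmass, d0, d1]
  simp only [hone, hzero, c2 a ha, c2 b hb]
  constructor
  · rintro ⟨-, -, h3, h4, h5⟩
    exact ⟨h5, (hbc h5).1.1 h3, (hbc h5).2.1 h4⟩
  · rintro ⟨h5, h3, h4⟩
    refine ⟨?_, ?_, (hbc h5).1.2 h3, (hbc h5).2.2 h4, h5⟩
    · intro x hx
      exact div_mul_cancel₀ _ (Real.rpow_pos_of_pos (hpos x hx.1) _).ne'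
    · intro x hx
      have : (fun y => √(((b ^ 3 - a ^ 3) * y + a ^ 3) ^ ((2:ℝ)/3)) *
          deriv (fun x => ((b ^ 3 - a ^ 3) * x + a ^ 3) ^ ((2:ℝ)/3)) y) =ᶠ[nhds x]
          fun _ => (b ^ 3 - a ^ 3) * (2/3) := by
        filter_upwards [Ioi_mem_nhds hx.1] with y hy
        have hy0 := hpos y (le_of_lt hy)
        rw [(ns_hasDeriv (b ^ 3 - a ^ 3) (a ^ 3) (2/3) y hy0).deriv, Real.sqrt_eq_rpow,
          ← Real.rpow_mul hy0.le, mul_left_comm, ← Real.rpow_add hy0]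
        norm_num
      rw [this.deriv_eq]
      simp

lemma ns_transfer (c θ₁ ε P : ℝ) (ρ θ ρ' θ' : ℝ → ℝ)
    (hρ : ∀ x ∈ Icc (0:ℝ) 1, ρ' x = ρ x)
    (hθ : ∀ x ∈ Icc (0:ℝ) 1, θ' =ᶠ[nhds x] θ)
    (h : IsNSSol c θ₁ ε P ρ θ) : IsNSSol c θ₁ ε P ρ' θ' := by
  obtain ⟨h1, h2, h3, h4, h5⟩ := h
  have m0 : (0:ℝ) ∈ Icc (0:ℝ) 1 := by simp
  have m1 : (1:ℝ) ∈ Icc (0:ℝ) 1 := by simp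
  refine ⟨?_, ?_, ?_, ?_, ?_⟩
  · intro x hx
    rw [hρ x hx, (hθ x hx).eq_of_nhds]; exact h1 x hx
  · intro x hx
    rw [← h2 x hx]
    apply Filter.EventuallyEq.deriv_eq
    have hx' := hθ x (Ioo_subset_Icc_self hx)
    filter_upwards [hx', hx'.deriv] with y e1 e2
    rw [e1, e2]
  · rw [(hθ 0 m0).eq_of_nhds, (hθ 0 m0).deriv_eq]; exact h3
  · rw [(hθ 1 m1).eq_of_nhds, (hθ 1 m1).deriv_eq]; exact h4
  · refine Eq.trans ?_ h5
    apply intervalIntegral.integral_congr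
    intro x hx
    rw [uIcc_of_le zero_le_one] at hx
    exact hρ x hx

/-- A globally smooth positive function equal to `y ^ (2/3)` for `y ≥ 1/2`. -/
lemma ns_ext : ∃ h : ℝ → ℝ, ContDiff ℝ (⊤ : ℕ∞) h ∧ (∀ y, 0 < h y) ∧
    ∀ y, 1 / 2 ≤ y → h y = y ^ ((2:ℝ)/3) := by
  have hb : ∀ y : ℝ, 0 < 1 / 4 + Real.smoothTransition (4 * y - 1) * (y - 1 / 4) := by
    intro y
    rcases le_total y (1 / 4) with h | h
    · rw [Real.smoothTransition.zero_of_nonpos (by linarith)]; norm_num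
    · have := mul_nonneg (Real.smoothTransition.nonneg (4 * y - 1)) (sub_nonneg.2 h)
      linarith
  refine ⟨fun y => (1 / 4 + Real.smoothTransition (4 * y - 1) * (y - 1 / 4)) ^ ((2:ℝ)/3),
    ?_, ?_, ?_⟩
  · apply ContDiff.rpow_const_of_ne
    · apply contDiff_const.add
      apply ContDiff.mul
      · exact Real.smoothTransition.contDiff.comp (by fun_prop)
      · fun_prop
    · intro x; exact (hb x).ne'
  · intro y; exact Real.rpow_pos_of_pos (hb y) _
  · intro y hy
    simp only
    rw [Real.smoothTransition.one_of_one_le (by linarith)]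
    congr 1; ring

lemma ns_bound (f : ℝ → ℝ) (hf : ContDiff ℝ (⊤ : ℕ∞) f) (M : ℝ) (i : ℕ) :
    ∃ C : ℝ, ∀ A D₁ D₂ x : ℝ, 0 ≤ A → A ≤ M → 0 ≤ D₁ → D₁ ≤ M → 0 ≤ D₁ * x + D₂ →
      D₁ * x + D₂ ≤ M → |iteratedDeriv i (fun y => A * f (D₁ * y + D₂) - 1) x| ≤ C := by
  have hfi : ContDiff ℝ i f := hf.of_le (by exact_mod_cast le_top)
  have hc : Continuous (iteratedDeriv i f) := hfi.continuous_iteratedDeriv' i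
  obtain ⟨B, hB⟩ := (isCompact_Icc (a := (0:ℝ)) (b := M)).exists_bound_of_continuousOn
    hc.continuousOn
  refine ⟨M * (M ^ i * B) + 1, ?_⟩
  intro A D₁ D₂ x hA hAM hD hDM h0 hM
  have hM0 : 0 ≤ M := hA.trans hAM
  have e1 : iteratedDeriv i (fun y => f (D₁ * y + D₂)) x
      = D₁ ^ i * iteratedDeriv i f (D₁ * x + D₂) := by
    have hg : ContDiff ℝ i (fun z => f (z + D₂)) := hfi.comp (by fun_prop)
    have := congrFun (iteratedDeriv_comp_const_mul hg D₁) x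
    rw [iteratedDeriv_comp_add_const] at this
    exact this
  have hcomp : ContDiff ℝ i (fun y => A * f (D₁ * y + D₂)) :=
    contDiff_const.mul (hfi.comp (by fun_prop))
  rw [iteratedDeriv_fun_sub hcomp.contDiffAt contDiff_const.contDiffAt,
    iteratedDeriv_const_mul_field, e1, iteratedDeriv_const]
  have hBx := hB (D₁ * x + D₂) ⟨h0, hM⟩
  rw [Real.norm_eq_abs] at hBx
  refine (abs_sub _ _).trans ?_
  have i1 : |A * (D₁ ^ i * iteratedDeriv i f (D₁ * x + D₂))| ≤ M * (M ^ i * B) := by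
    rw [abs_mul, abs_mul, abs_of_nonneg hA, abs_of_nonneg (pow_nonneg hD i)]
    gcongr
  have i2 : |(if i = 0 then (1:ℝ) else 0)| ≤ 1 := by split_ifs <;> simp
  linarith

/-- Existence, uniform-in-`ε` smooth bounds, and local uniqueness for the steady
compressible Navier–Stokes problem with slip boundary conditions (`θ₀ = 1 < θ₁`). -/
theorem stmt4 (θ₁ c : ℝ) (hθ₁ : 1 < θ₁) :
    ∃ ε₀ > (0:ℝ), ∃ P : ℝ → ℝ, ∃ R T : ℝ → ℝ → ℝ,
      (∀ ε ∈ Ioo (0:ℝ) ε₀,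
        0 < P ε ∧ ContDiff ℝ (⊤ : ℕ∞) (R ε) ∧ ContDiff ℝ (⊤ : ℕ∞) (T ε) ∧
        (∀ x ∈ Icc (0:ℝ) 1, 0 < R ε x ∧ 0 < T ε x) ∧
        IsNSSol c θ₁ ε (P ε) (R ε) (T ε)) ∧
      (∀ k : ℕ, ∃ C > (0:ℝ), ∀ ε ∈ Ioo (0:ℝ) ε₀, ∀ x ∈ Icc (0:ℝ) 1,
        ∑ i ∈ Finset.range (k + 1),
          (|iteratedDeriv i (fun y => R ε y - 1) x| +
           |iteratedDeriv i (fun y => T ε y - 1) x|) ≤ C * (θ₁ - 1)) ∧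
      (∃ U : Set (ℝ × ℝ × ℝ), IsOpen U ∧
        (θ₁ ^ ((3:ℝ)/2) - 1, 1, (θ₁ ^ ((3:ℝ)/2) - 1) / (3 * (θ₁ ^ ((1:ℝ)/2) - 1))) ∈ U ∧
        ∀ ε ∈ Ioo (0:ℝ) ε₀, ∃! d : ℝ × ℝ × ℝ, d ∈ U ∧
          IsNSSol c θ₁ ε d.2.2
            (fun x => d.2.2 / (d.1 * x + d.2.1) ^ ((2:ℝ)/3))
            (fun x => (d.1 * x + d.2.1) ^ ((2:ℝ)/3))) := by
  obtain ⟨h, hsm, hpos, heq⟩ := ns_ext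
  have hθ0 : 0 < 1 + θ₁ := by linarith
  have hsmall : ∀ ε ∈ Ioo (0:ℝ) (1 / (32 * (1 + θ₁) * (1 + |c|))),
      |2 * c * ε| * (16 * (1 + θ₁)) ≤ 1 := by
    intro ε hε
    have h1 := hε.2
    rw [lt_div_iff₀ (by positivity)] at h1
    rw [abs_mul, abs_mul, abs_of_pos hε.1, abs_two]
    have : 0 < ε * (32 * (1 + θ₁)) := mul_pos hε.1 (by positivity)
    nlinarith [abs_nonneg c]
  have hex : ∀ ε : ℝ, ∃ a b : ℝ, ε ∈ Ioo (0:ℝ) (1 / (32 * (1 + θ₁) * (1 + |c|))) →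
      9 / 10 ≤ a ∧ a < b ∧ b ≤ 2 * θ₁ ∧
      (1 + 2 * c * ε) * a ^ 2 - 2 * c * ε * (a * b) = 1 ∧
      (1 + 2 * c * ε) * b ^ 2 - 2 * c * ε * (a * b) = θ₁ := by
    intro ε
    by_cases hε : ε ∈ Ioo (0:ℝ) (1 / (32 * (1 + θ₁) * (1 + |c|)))
    · obtain ⟨a, b, hab⟩ := ns_alg_exists θ₁ (2 * c * ε) hθ₁ (hsmall ε hε)
      exact ⟨a, b, fun _ => hab⟩
    · exact ⟨0, 0, fun h => absurd h hε⟩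
  choose a b hab using hex
  have hcube : ∀ ε ∈ Ioo (0:ℝ) (1 / (32 * (1 + θ₁) * (1 + |c|))),
      1 / 2 < a ε ^ 3 ∧ a ε ^ 3 < b ε ^ 3 := by
    intro ε hε
    obtain ⟨h1, h2, -⟩ := hab ε hε
    constructor
    · have := pow_le_pow_left₀ (by norm_num) h1 3
      norm_num at this ⊢
      linarith
    · exact pow_lt_pow_left₀ h2 (by linarith) (by norm_num)
  have hsol : ∀ ε ∈ Ioo (0:ℝ) (1 / (32 * (1 + θ₁) * (1 + |c|))),
      0 < (a ε ^ 2 + a ε * b ε + b ε ^ 2) / 3 ∧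
      IsNSSol c θ₁ ε ((a ε ^ 2 + a ε * b ε + b ε ^ 2) / 3)
        (fun x => ((a ε ^ 2 + a ε * b ε + b ε ^ 2) / 3) /
          ((b ε ^ 3 - a ε ^ 3) * x + a ε ^ 3) ^ ((2:ℝ)/3))
        (fun x => ((b ε ^ 3 - a ε ^ 3) * x + a ε ^ 3) ^ ((2:ℝ)/3)) := by
    intro ε hε
    obtain ⟨h1, h2, h3, h4, h5⟩ := hab ε hε
    have ha : 0 < a ε := by linarith
    have hb : 0 < b ε := by linarith
    have hP : 0 < (a ε ^ 2 + a ε * b ε + b ε ^ 2) / 3 := by positivity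
    exact ⟨hP, (ns_key c θ₁ ε _ _ _ ha h2 hP).2 ⟨rfl, h4, h5⟩⟩
  have hsm' : ContDiff ℝ (⊤ : ℕ∞) (fun y => (h y)⁻¹) := hsm.inv fun y => (hpos y).ne'
  refine ⟨1 / (32 * (1 + θ₁) * (1 + |c|)), by positivity,
    fun ε => (a ε ^ 2 + a ε * b ε + b ε ^ 2) / 3,
    fun ε x => ((a ε ^ 2 + a ε * b ε + b ε ^ 2) / 3) *
      (fun y => (h y)⁻¹) ((b ε ^ 3 - a ε ^ 3) * x + a ε ^ 3),
    fun ε x => 1 * h ((b ε ^ 3 - a ε ^ 3) * x + a ε ^ 3), ?_, ?_, ?_⟩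
  · intro ε hε
    obtain ⟨hP, hS⟩ := hsol ε hε
    obtain ⟨hc1, hc2⟩ := hcube ε hε
    have hge : ∀ x ∈ Icc (0:ℝ) 1, 1 / 2 < (b ε ^ 3 - a ε ^ 3) * x + a ε ^ 3 := by
      intro x hx
      have := mul_nonneg (sub_pos.2 hc2).le hx.1
      linarith
    refine ⟨hP, ?_, ?_, ?_, ?_⟩
    · exact contDiff_const.mul (hsm'.comp (by fun_prop))
    · exact contDiff_const.mul (hsm.comp (by fun_prop))
    · intro x hx
      exact ⟨mul_pos hP (inv_pos.2 (hpos _)), mul_pos one_pos (hpos _)⟩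
    · refine ns_transfer _ _ _ _ _ _ _ _ ?_ ?_ hS
      · intro x hx
        simp only
        rw [heq _ (hge x hx).le]
        exact (div_eq_mul_inv _ _).symm
      · intro x hx
        have hcont : ContinuousAt (fun x => (b ε ^ 3 - a ε ^ 3) * x + a ε ^ 3) x := by fun_prop
        filter_upwards [hcont.eventually (lt_mem_nhds (hge x hx))] with y hy
        rw [heq _ hy.le, one_mul]
  · intro k
    choose C₁ hC₁ using ns_bound _ hsm' (8 * θ₁ ^ 3)
    choose C₂ hC₂ using ns_bound _ hsm (8 * θ₁ ^ 3)
    have hθ1 : 0 < θ₁ - 1 := by linarith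
    refine ⟨(∑ i ∈ Finset.range (k + 1), (|C₁ i| + |C₂ i|) + 1) / (θ₁ - 1), ?_, ?_⟩
    · have : 0 ≤ ∑ i ∈ Finset.range (k + 1), (|C₁ i| + |C₂ i|) :=
        Finset.sum_nonneg fun i _ => by positivity
      positivity
    · intro ε hε x hx
      rw [div_mul_cancel₀ _ hθ1.ne']
      obtain ⟨hP, -⟩ := hsol ε hε
      obtain ⟨hc1, hc2⟩ := hcube ε hε
      obtain ⟨h1, h2, h3, -⟩ := hab ε hε
      have ha : 0 < a ε := by linarith
      have hb : 0 < b ε := by linarith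
      have hb3 : b ε ^ 3 ≤ 8 * θ₁ ^ 3 := by
        have := pow_le_pow_left₀ hb.le h3 3
        linarith [show (2 * θ₁) ^ 3 = 8 * θ₁ ^ 3 by ring]
      have hθ2 : 1 ≤ θ₁ ^ 2 := one_le_pow₀ hθ₁.le
      have hθ3 : θ₁ ^ 2 ≤ θ₁ ^ 3 := pow_le_pow_right₀ hθ₁.le (by norm_num)
      have hPM : (a ε ^ 2 + a ε * b ε + b ε ^ 2) / 3 ≤ 8 * θ₁ ^ 3 := by
        have e1 : a ε ^ 2 ≤ b ε ^ 2 := pow_le_pow_left₀ ha.le h2.le 2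
        have e2 : a ε * b ε ≤ b ε ^ 2 := by nlinarith
        have e3 : b ε ^ 2 ≤ (2 * θ₁) ^ 2 := pow_le_pow_left₀ hb.le h3 2
        nlinarith
      have hx1 : 0 ≤ (b ε ^ 3 - a ε ^ 3) * x := mul_nonneg (sub_pos.2 hc2).le hx.1
      have hx2 : (b ε ^ 3 - a ε ^ 3) * x ≤ b ε ^ 3 - a ε ^ 3 :=
        mul_le_of_le_one_right (sub_pos.2 hc2).le hx.2
      have hsum : ∑ i ∈ Finset.range (k + 1), (|iteratedDeriv i (fun y =>
            ((a ε ^ 2 + a ε * b ε + b ε ^ 2) / 3) *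
            (fun y => (h y)⁻¹) ((b ε ^ 3 - a ε ^ 3) * y + a ε ^ 3) - 1) x| +
           |iteratedDeriv i (fun y => 1 * h ((b ε ^ 3 - a ε ^ 3) * y + a ε ^ 3) - 1) x|)
          ≤ ∑ i ∈ Finset.range (k + 1), (|C₁ i| + |C₂ i|) := by
        apply Finset.sum_le_sum
        intro i _
        apply add_le_add
        · exact (hC₁ i _ _ _ x hP.le hPM (by linarith) (by linarith) (by linarith)
            (by linarith)).trans (le_abs_self _)
        · exact (hC₂ i _ _ _ x zero_le_one (by linarith) (by linarith) (by linarith) (by linarith)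
            (by linarith)).trans (le_abs_self _)
      exact hsum.trans (by linarith)
  · refine ⟨{d | 0 < d.1 ∧ 1 / 2 < d.2.1 ∧ 0 < d.2.2}, ?_, ?_, ?_⟩
    · apply IsOpen.inter
      · exact isOpen_lt continuous_const continuous_fst
      · apply IsOpen.inter
        · exact isOpen_lt continuous_const (continuous_fst.comp continuous_snd)
        · exact isOpen_lt continuous_const (continuous_snd.comp continuous_snd)
    · have e1 : 1 < θ₁ ^ ((3:ℝ)/2) := Real.one_lt_rpow hθ₁ (by norm_num)
      have e2 : 1 < θ₁ ^ ((1:ℝ)/2) := Real.one_lt_rpow hθ₁ (by norm_num)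
      refine ⟨by simpa using e1, by norm_num, ?_⟩
      exact div_pos (by linarith) (by linarith)
    · intro ε hε
      obtain ⟨hP, hS⟩ := hsol ε hε
      obtain ⟨hc1, hc2⟩ := hcube ε hε
      obtain ⟨h1, h2, h3, h4, h5⟩ := hab ε hε
      refine ⟨(b ε ^ 3 - a ε ^ 3, a ε ^ 3, (a ε ^ 2 + a ε * b ε + b ε ^ 2) / 3),
        ⟨⟨sub_pos.2 hc2, hc1, hP⟩, hS⟩, ?_⟩
      rintro ⟨D₁, D₂, Q⟩ ⟨⟨g1, g2, g3⟩, hS'⟩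
      simp only at g1 g2 g3 hS'
      have hD2 : 0 < D₂ := by linarith
      obtain ⟨a', ha', rfl⟩ : ∃ t : ℝ, 0 < t ∧ t ^ 3 = D₂ := by
        refine ⟨D₂ ^ ((1:ℝ)/3), Real.rpow_pos_of_pos hD2 _, ?_⟩
        rw [← Real.rpow_natCast, ← Real.rpow_mul hD2.le]; norm_num
      obtain ⟨b', hb', hbe⟩ : ∃ t : ℝ, 0 < t ∧ t ^ 3 = D₁ + a' ^ 3 := by
        have hDD : 0 < D₁ + a' ^ 3 := by linarith
        refine ⟨(D₁ + a' ^ 3) ^ ((1:ℝ)/3), Real.rpow_pos_of_pos hDD _, ?_⟩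
        rw [← Real.rpow_natCast, ← Real.rpow_mul hDD.le]; norm_num
      obtain rfl : D₁ = b' ^ 3 - a' ^ 3 := by linarith
      have hab' : a' < b' := lt_of_pow_lt_pow_left₀ 3 hb'.le (by linarith)
      obtain ⟨q1, q2, q3⟩ := (ns_key c θ₁ ε Q a' b' ha' hab' g3).1 hS'
      obtain ⟨r1, r2⟩ := ns_alg_unique θ₁ (2 * c * ε) a' b' (a ε) (b ε) hθ₁ (hsmall ε hε)
        ha' hb' (by linarith) (by linarith) q2 q3 h4 h5
      rw [q1, r1, r2]
end

section
/- Define, for suitable f : ℝ³ → ℝ, the operators K₁f(v) = ∫_{ℝ³}∫_{S²} |(v−u)·ω| √(μ(v)μ(u)) f(u) dω du and K₂f(v) = ∫_{ℝ³}∫_{S²} |(v−u)·ω| √(μ(u)μ(u')) f(v') dω du + ∫_{ℝ³}∫_{S²} |(v−u)·ω| √(μ(u)μ(v')) f(u') dω du, and set Kf = K₂f − K₁f, so that the linearized hard-sphere Boltzmann operator Lf := −μ^{−1/2}[Q(μ, √μ f) + Q(√μ f, μ)] satisfies Lf = ν f − K f. Then K is an integral operator: there exists a measurable function k : ℝ³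 × ℝ³ → ℝ such that Kf(v) = ∫_{ℝ³} k(v,u) f(u) du (for all bounded measurable f with Gaussian decay), and there is C > 0 such that |k(v,u)| ≤ C (|v−u| + |v−u|^{−1}) e^{−|v−u|²/8} e^{−(|v|²−|u|²)²/(8|v−u|²)} for all v, u ∈ ℝ³ with v ≠ u. -/
open Real MeasureTheory
open scoped RealInnerProductSpace

noncomputable section

/-- Velocity space `ℝ³`. -/
abbrev V := EuclideanSpace ℝ (Fin 3)

/-- Surface measure on the unit sphere `S² ⊂ ℝ³`. -/
def sphμ : Measure (Metric.sphere (0:V) 1) := (volume : Measure V).toSphere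

/-- The normalized global Maxwellian `μ(v) = (2π)^{−3/2} e^{−|v|²/2}`. -/
def gaussM (v : V) : ℝ := (2 * π) ^ (-(3:ℝ)/2) * Real.exp (-‖v‖ ^ 2 / 2)

/-- Post-collisional velocity `v' = v − ((v−u)·ω)ω`. -/
def vPrime (v u : V) (ω : Metric.sphere (0:V) 1) : V := v - ⟪v - u, (ω : V)⟫ • (ω : V)

/-- Post-collisional velocity `u' = u + ((v−u)·ω)ω`. -/
def uPrime (v u : V) (ω : Metric.sphere (0:V) 1) : V := u + ⟪v - u, (ω : V)⟫ • (ω : V)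

/-- The hard-sphere Boltzmann collision operator. -/
def Qop (F₁ F₂ : V → ℝ) (v : V) : ℝ :=
  ∫ u : V, ∫ ω : Metric.sphere (0:V) 1,
    |⟪v - u, (ω : V)⟫| * (F₁ (uPrime v u ω) * F₂ (vPrime v u ω) - F₁ u * F₂ v) ∂sphμ

/-- The collision frequency `ν(v) = ∫∫ |(v−u)·ω| μ(u) dω du`. -/
def collFreq (v : V) : ℝ :=
  ∫ u : V, (∫ ω : Metric.sphere (0:V) 1, |⟪v - u, (ω : V)⟫| ∂sphμ) * gaussM u

/-- `K₁f(v) = ∫∫ |(v−u)·ω| √(μ(v)μ(u)) f(u) dω du`. -/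
def K1op (f : V → ℝ) (v : V) : ℝ :=
  ∫ u : V, (∫ ω : Metric.sphere (0:V) 1, |⟪v - u, (ω : V)⟫| ∂sphμ) *
    Real.sqrt (gaussM v * gaussM u) * f u

/-- `K₂f(v) = ∫∫ |(v−u)·ω| √(μ(u)μ(u')) f(v') dω du + ∫∫ |(v−u)·ω| √(μ(u)μ(v')) f(u') dω du`. -/
def K2op (f : V → ℝ) (v : V) : ℝ :=
  (∫ u : V, ∫ ω : Metric.sphere (0:V) 1,
    |⟪v - u, (ω : V)⟫| * Real.sqrt (gaussM u * gaussM (uPrime v u ω)) * f (vPrime v u ω) ∂sphμ) +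
  ∫ u : V, ∫ ω : Metric.sphere (0:V) 1,
    |⟪v - u, (ω : V)⟫| * Real.sqrt (gaussM u * gaussM (vPrime v u ω)) * f (uPrime v u ω) ∂sphμ

/-- `K = K₂ − K₁`. -/
def Kop (f : V → ℝ) (v : V) : ℝ := K2op f v - K1op f v

/-- The linearized operator `Lf = −μ^{−1/2}[Q(μ, √μ f) + Q(√μ f, μ)]`. -/
def Lop (f : V → ℝ) (v : V) : ℝ :=
  -(Qop gaussM (fun u => Real.sqrt (gaussM u) * f u) v +
    Qop (fun u => Real.sqrt (gaussM u) * f u) gaussM v) / Real.sqrt (gaussM v)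

/-! ### Coordinates -/

def toVE : (ℝ × ℝ × ℝ) ≃ᵐ V :=
  ((MeasurableEquiv.prodCongr (MeasurableEquiv.refl ℝ) (MeasurableEquiv.finTwoArrow (α := ℝ)).symm).trans
    (MeasurableEquiv.piFinSuccAbove (fun _ : Fin 3 => ℝ) 0).symm).trans
    (MeasurableEquiv.toLp 2 (Fin 3 → ℝ))

lemma toVE_apply (p : ℝ × ℝ × ℝ) : toVE p = !₂[p.1, p.2.1, p.2.2] := by
  ext i
  fin_cases i <;> rfl

lemma toVE_mp : MeasurePreserving toVE := by
  refine (PiLp.volume_preserving_toLp (Fin 3)).comp ?_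
  refine ((volume_preserving_piFinSuccAbove (fun _ : Fin 3 => ℝ) 0).symm).comp ?_
  exact (MeasurePreserving.id _).prod (volume_preserving_finTwoArrow ℝ).symm

lemma toVE_norm_sq (p : ℝ × ℝ × ℝ) : ‖toVE p‖ ^ 2 = p.1 ^ 2 + (p.2.1 ^ 2 + p.2.2 ^ 2) := by
  rw [toVE_apply, EuclideanSpace.norm_sq_eq]
  simp [Fin.sum_univ_three]; ring

def e0 : V := EuclideanSpace.single 0 1

lemma norm_e0 : ‖e0‖ = 1 := by simp [e0]

lemma inner_toVE_e0 (p : ℝ × ℝ × ℝ) : ⟪toVE p, e0⟫ = p.1 := by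
  rw [toVE_apply, e0, EuclideanSpace.inner_single_right]; simp

lemma exists_rot (z w : V) (h : ‖z‖ = ‖w‖) : ∃ R : V ≃ₗᵢ[ℝ] V, R z = w :=
  ⟨_, Submodule.reflection_sub h⟩

/-- Gaussian slicing. -/
lemma slice_int (h : ℝ → ℝ) (ω : V) (hω : ‖ω‖ = 1) :
    ∫ z : V, h ⟪z, ω⟫ * Real.exp (-(‖z‖ ^ 2 - ⟪z, ω⟫ ^ 2) / 2) = 2 * π * ∫ r : ℝ, h r := by
  obtain ⟨R, hR⟩ := exists_rot e0 ω (by rw [hω, norm_e0])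
  rw [← R.measurePreserving.integral_comp R.toHomeomorph.measurableEmbedding]
  rw [← toVE_mp.integral_comp toVE.measurableEmbedding]
  have : ∀ p : ℝ × ℝ × ℝ, h ⟪R (toVE p), ω⟫ *
      Real.exp (-(‖R (toVE p)‖ ^ 2 - ⟪R (toVE p), ω⟫ ^ 2) / 2) =
      h p.1 * (Real.exp (-(1/2) * p.2.1 ^ 2) * Real.exp (-(1/2) * p.2.2 ^ 2)) := by
    intro p
    rw [← hR, R.inner_map_map, R.norm_map, inner_toVE_e0, toVE_norm_sq, ← Real.exp_add]
    congr 2; ring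
  simp_rw [this]
  rw [MeasureTheory.Measure.volume_eq_prod]
  rw [integral_prod_mul (fun x => h x) (fun y : ℝ × ℝ => Real.exp (-(1/2) * y.1 ^ 2) * Real.exp (-(1/2) * y.2 ^ 2))]
  rw [MeasureTheory.Measure.volume_eq_prod]
  rw [integral_prod_mul (fun x : ℝ => Real.exp (-(1/2) * x ^ 2)) (fun x : ℝ => Real.exp (-(1/2) * x ^ 2)), integral_gaussian]
  rw [Real.mul_self_sqrt (by positivity)]
  ring

/-! ### Polar coordinates -/

lemma finrankV : Module.finrank ℝ V = 3 := by simp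

instance : IsFiniteMeasure sphμ := by unfold sphμ; infer_instance

lemma polar_mp : MeasurePreserving (homeomorphUnitSphereProd V)
    ((volume : Measure V).comap (↑)) (sphμ.prod (Measure.volumeIoiPow 2)) := by
  have := (volume : Measure V).measurePreserving_homeomorphUnitSphereProd
  rw [finrankV] at this
  exact this

abbrev S2 := Metric.sphere (0:V) 1

lemma polar_symm_coe (x : ({0}ᶜ : Set V)) :
    (((homeomorphUnitSphereProd V x).2 : ℝ) • ((homeomorphUnitSphereProd V x).1 : V)) = x := by
  have := (homeomorphUnitSphereProd V).symm_apply_apply x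
  conv_rhs => rw [← this]
  rfl

lemma polar_lin (F : V → ENNReal) (hF : Measurable F) :
    ∫⁻ x, F x = ∫⁻ ω : S2, (∫⁻ r in Set.Ioi (0:ℝ), ENNReal.ofReal (r ^ 2) * F (r • (ω : V))) ∂sphμ := by
  have h1 : ∫⁻ x, F x = ∫⁻ x : ({0}ᶜ : Set V), F x ∂((volume : Measure V).comap (↑)) := by
    rw [lintegral_subtype_comap (measurableSet_singleton _).compl, restrict_compl_singleton]
  have hm : Measurable (fun p : S2 × Set.Ioi (0:ℝ) => F ((p.2 : ℝ) • (p.1 : V))) := by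
    apply hF.comp; fun_prop
  have h2 := polar_mp.lintegral_comp hm
  simp_rw [polar_symm_coe] at h2
  rw [h1, h2, lintegral_prod _ hm.aemeasurable]
  refine lintegral_congr fun ω => ?_
  have hm2 : Measurable (fun r : ℝ => F (r • (ω : V))) := by apply hF.comp; fun_prop
  rw [← lintegral_subtype_comap measurableSet_Ioi, Measure.volumeIoiPow]
  exact lintegral_withDensity_eq_lintegral_mul _ (by fun_prop)
    (hm2.comp measurable_subtype_coe)

lemma polar_int (F : V → ℝ) (hF : Integrable F) :
    ∫ x, F x = ∫ ω : S2, (∫ r in Set.Ioi (0:ℝ), r ^ 2 * F (r • (ω : V))) ∂sphμ := by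
  have h1 : ∫ x, F x = ∫ x : ({0}ᶜ : Set V), F x ∂((volume : Measure V).comap (↑)) := by
    rw [integral_subtype_comap (measurableSet_singleton _).compl F, restrict_compl_singleton]
  have hemb : MeasurableEmbedding (homeomorphUnitSphereProd V) :=
    (homeomorphUnitSphereProd V).measurableEmbedding
  have h2 := polar_mp.integral_comp hemb (fun p : S2 × Set.Ioi (0:ℝ) => F ((p.2 : ℝ) • (p.1 : V)))
  have h3 := polar_mp.integrable_comp_emb hemb (g := fun p : S2 × Set.Ioi (0:ℝ) => F ((p.2 : ℝ) • (p.1 : V)))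
  simp only [Function.comp_def, polar_symm_coe] at h2 h3
  have h4 : Integrable (fun x : ({0}ᶜ : Set V) => F x) ((volume : Measure V).comap (↑)) := by
    have := (integrableOn_iff_comap_subtypeVal (μ := (volume : Measure V)) (s := ({0}ᶜ : Set V))
      (f := F) (measurableSet_singleton _).compl).1 hF.integrableOn
    exact this
  rw [h1, h2, integral_prod _ (h3.1 h4)]
  refine integral_congr_ae (Filter.Eventually.of_forall fun ω => ?_)
  simp only [Measure.volumeIoiPow, ENNReal.ofReal]
  rw [integral_withDensity_eq_integral_smul (by fun_prop),
    integral_subtype_comap measurableSet_Ioi fun a ↦ Real.toNNReal (a ^ 2) • F (a • (ω : V)),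
    setIntegral_congr_fun measurableSet_Ioi fun x hx ↦ ?_]
  rw [NNReal.smul_def, Real.coe_toNNReal _ (sq_nonneg _), smul_eq_mul]

def cG : ENNReal := ∫⁻ r in Set.Ioi (0:ℝ), ENNReal.ofReal (r ^ 2) * ENNReal.ofReal (Real.exp (-r ^ 2 / 2))

lemma cG_ne_zero : cG ≠ 0 := by
  unfold cG
  rw [Ne, setLIntegral_eq_zero_iff measurableSet_Ioi (by fun_prop)]
  intro h
  have h2 : ∀ᵐ x : ℝ, x ∉ Set.Ioi (0:ℝ) := by
    filter_upwards [h] with x hx hx0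
    have := hx hx0
    simp only [mul_eq_zero, ENNReal.ofReal_eq_zero] at this
    have h3 : (0:ℝ) < x := hx0
    have h4 : 0 < x ^ 2 := by positivity
    rcases this with h | h
    · linarith
    · linarith [Real.exp_pos (-x^2/2)]
  have h3 : volume (Set.Ioi (0:ℝ)) = 0 := by
    rw [measure_eq_zero_iff_ae_notMem]; exact h2
  simp at h3

lemma cG_ne_top : cG ≠ ⊤ := by
  have h := (integrable_rpow_mul_exp_neg_mul_sq (b := 1/2) (by norm_num) (s := 2) (by norm_num)).integrableOn (s := Set.Ioi (0:ℝ))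
  have := h.lintegral_lt_top
  unfold cG
  refine ne_of_lt (lt_of_le_of_lt (le_of_eq ?_) this)
  refine lintegral_congr fun r => ?_
  rw [← ENNReal.ofReal_mul (sq_nonneg _)]
  have e1 : r ^ (2:ℝ) = r ^ 2 := by norm_cast
  rw [e1]
  congr 3
  ring

lemma sph_lin (Φ : V → ENNReal) (hΦ : Measurable Φ) :
    ∫⁻ x : V, Φ (‖x‖⁻¹ • x) * ENNReal.ofReal (Real.exp (-‖x‖ ^ 2 / 2)) = cG * ∫⁻ ω : S2, Φ ω ∂sphμ := by
  rw [polar_lin _ (by fun_prop)]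
  have : ∀ ω : S2, (∫⁻ r in Set.Ioi (0:ℝ), ENNReal.ofReal (r ^ 2) *
      (Φ (‖r • (ω : V)‖⁻¹ • r • (ω : V)) * ENNReal.ofReal (Real.exp (-‖r • (ω : V)‖ ^ 2 / 2)))) = cG * Φ ω := by
    intro ω
    unfold cG
    rw [← lintegral_mul_const _ (by fun_prop)]
    refine setLIntegral_congr_fun measurableSet_Ioi fun r hr => ?_
    have hr' : (0:ℝ) < r := hr
    have : ‖r • (ω : V)‖ = r := by
      rw [norm_smul, norm_eq_of_mem_sphere, mul_one, Real.norm_of_nonneg hr'.le]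
    simp only [this, smul_smul, inv_mul_cancel₀ hr'.ne', one_smul]
    ring
  simp_rw [this]
  rw [lintegral_const_mul]
  exact hΦ.comp measurable_subtype_coe

lemma sph_lin_rot (Φ : V → ENNReal) (hΦ : Measurable Φ) (R : V ≃ₗᵢ[ℝ] V) :
    ∫⁻ ω : S2, Φ (R ω) ∂sphμ = ∫⁻ ω : S2, Φ ω ∂sphμ := by
  have hR : Measurable R := R.continuous.measurable
  have h1 := sph_lin Φ hΦ
  have h2 := sph_lin (fun x => Φ (R x)) (hΦ.comp hR)
  have h3 := R.measurePreserving.lintegral_comp_emb R.toHomeomorph.measurableEmbedding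
    (fun x : V => Φ (‖x‖⁻¹ • x) * ENNReal.ofReal (Real.exp (-‖x‖ ^ 2 / 2)))
  simp only [R.norm_map, map_smul] at h2 h3
  rw [h2, h1] at h3
  exact (ENNReal.mul_right_inj cG_ne_zero cG_ne_top).1 h3

lemma sph_neg_mp : MeasurePreserving (fun ω : S2 => -ω) sphμ sphμ := by
  refine ⟨continuous_neg.measurable, ?_⟩
  ext s hs
  rw [Measure.map_apply continuous_neg.measurable hs]
  have hs' : MeasurableSet ((↑) '' s : Set V) :=
    (MeasurableEmbedding.subtype_coe Metric.isClosed_sphere.measurableSet).measurableSet_image.2 hs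
  have := sph_lin_rot (Set.indicator ((↑) '' s : Set V) 1) (measurable_one.indicator hs') (LinearIsometryEquiv.neg ℝ)
  have e1 : ∀ ω : S2, Set.indicator ((↑) '' s : Set V) (1 : V → ENNReal) (ω : V) = s.indicator 1 ω := by
    intro ω
    by_cases h : ω ∈ s <;> simp [Set.indicator, h]
  have e2 : ∀ ω : S2, Set.indicator ((↑) '' s : Set V) (1 : V → ENNReal) ((LinearIsometryEquiv.neg ℝ) (ω : V))
      = ((fun ω : S2 => -ω) ⁻¹' s).indicator 1 ω := by
    intro ω
    have := e1 (-ω)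
    simp only [LinearIsometryEquiv.coe_neg]
    rw [coe_neg_sphere] at this
    rw [this]
    rfl
  simp_rw [e1, e2] at this
  rwa [lintegral_indicator_one hs, lintegral_indicator_one (continuous_neg.measurable hs)] at this

/-! ### The pre/post-collisional swap -/

lemma lin_half (m : ℝ → ENNReal) (hm : Measurable m) :
    ∫⁻ x, m x = ∫⁻ x in Set.Ioi (0:ℝ), (m x + m (-x)) := by
  rw [lintegral_add_left hm, ← lintegral_add_compl m (measurableSet_Ioi (a := (0:ℝ)))]
  congr 1
  rw [Set.compl_Ioi, restrict_Iio_eq_restrict_Iic.symm]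
  have := (Measure.measurePreserving_neg (volume : Measure ℝ)).setLIntegral_comp_preimage
    (s := Set.Iio (0:ℝ)) measurableSet_Iio hm
  rw [← this]
  congr 2
  ext x; simp

lemma cyl_lin (Φ : ℝ × ℝ × ℝ → ENNReal) (hΦ : Measurable Φ) :
    ∫⁻ p, ENNReal.ofReal |p.1| * Φ p =
      ∫⁻ φ in Set.Ioo (-π) π, ∫⁻ ρ in Set.Ioi (0:ℝ), ∫⁻ a in Set.Ioi (0:ℝ),
        ENNReal.ofReal ρ * (ENNReal.ofReal a *
          (Φ (a, ρ * cos φ, ρ * sin φ) + Φ (-a, ρ * cos φ, ρ * sin φ))) := by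
  rw [MeasureTheory.Measure.volume_eq_prod, lintegral_prod_symm _ (by fun_prop)]
  have h1 : ∀ y : ℝ × ℝ, ∫⁻ x, ENNReal.ofReal |(x, y).1| * Φ (x, y) =
      ∫⁻ a in Set.Ioi (0:ℝ), ENNReal.ofReal a * (Φ (a, y) + Φ (-a, y)) := by
    intro y
    rw [lin_half _ (by fun_prop)]
    refine setLIntegral_congr_fun measurableSet_Ioi fun r hr => ?_
    have hr' : (0:ℝ) < r := hr
    simp only [abs_neg, abs_of_pos hr']
    ring
  simp_rw [h1]
  rw [← lintegral_comp_polarCoord_symm]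
  have ht : polarCoord.target = Set.Ioi (0:ℝ) ×ˢ Set.Ioo (-π) π := rfl
  rw [ht, MeasureTheory.Measure.volume_eq_prod, ← Measure.prod_restrict]
  simp only [polarCoord_symm_apply, smul_eq_mul]
  have hm : Measurable (fun q : (ℝ × ℝ) × ℝ => ENNReal.ofReal q.2 *
      (Φ (q.2, q.1.1 * cos q.1.2, q.1.1 * sin q.1.2) +
        Φ (-q.2, q.1.1 * cos q.1.2, q.1.1 * sin q.1.2))) := by
    fun_prop
  have hm2 := hm.lintegral_prod_right' (ν := volume.restrict (Set.Ioi (0:ℝ)))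
  rw [lintegral_prod_symm]
  · refine lintegral_congr fun φ => lintegral_congr fun ρ => ?_
    rw [lintegral_const_mul]
    exact hm.comp (measurable_const.prodMk measurable_id : Measurable (fun a : ℝ => ((ρ, φ), a)))
  · exact ((by fun_prop : Measurable (fun q : ℝ × ℝ => ENNReal.ofReal q.1)).mul hm2).aemeasurable

lemma sphB_e0 (t : ℝ) (g : V → ENNReal) (hg : Measurable g) :
    ∫⁻ ω : S2, ENNReal.ofReal |⟪t • e0, (ω : V)⟫| * g (⟪t • e0, (ω : V)⟫ • (ω : V)) ∂sphμ =
    ∫⁻ ω : S2, ENNReal.ofReal |⟪t • e0, (ω : V)⟫| * g (t • e0 - ⟪t • e0, (ω : V)⟫ • (ω : V)) ∂sphμ := by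
  have hA := sph_lin (fun x => ENNReal.ofReal |⟪t • e0, x⟫| * g (⟪t • e0, x⟫ • x)) (by fun_prop)
  have hB := sph_lin (fun x => ENNReal.ofReal |⟪t • e0, x⟫| * g (t • e0 - ⟪t • e0, x⟫ • x)) (by fun_prop)
  refine (ENNReal.mul_right_inj cG_ne_zero cG_ne_top).1 ?_
  rw [← hA, ← hB]
  rw [← toVE_mp.lintegral_comp_emb toVE.measurableEmbedding, ← toVE_mp.lintegral_comp_emb toVE.measurableEmbedding]
  let n : ℝ × ℝ × ℝ → ℝ := fun p => p.1 ^ 2 + (p.2.1 ^ 2 + p.2.2 ^ 2)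
  have hn : Measurable n := by fun_prop
  let W : ℝ → ENNReal := fun s => ENNReal.ofReal (|t| * (√s)⁻¹) * ENNReal.ofReal (Real.exp (-s / 2))
  have hW : Measurable W := by fun_prop
  have hT : Measurable toVE := toVE.measurable
  let ΦA : ℝ × ℝ × ℝ → ENNReal := fun p => W (n p) * g ((t * p.1 * (n p)⁻¹) • toVE p)
  let ΦB : ℝ × ℝ × ℝ → ENNReal := fun p => W (n p) * g (t • e0 - (t * p.1 * (n p)⁻¹) • toVE p)
  have hΦA : Measurable ΦA := by fun_prop
  have hΦB : Measurable ΦB := by fun_prop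
  have hnorm : ∀ p, ‖toVE p‖ = √(n p) := fun p => by
    rw [← Real.sqrt_sq (norm_nonneg _), toVE_norm_sq]
  have hnn : ∀ p, 0 ≤ n p := fun p => by positivity
  have hin : ∀ p, ⟪t • e0, ‖toVE p‖⁻¹ • toVE p⟫ = t * (√(n p))⁻¹ * p.1 := by
    intro p
    rw [real_inner_smul_left, real_inner_smul_right, real_inner_comm, inner_toVE_e0, hnorm]; ring
  have habs : ∀ p, ENNReal.ofReal |t * (√(n p))⁻¹ * p.1| =
      ENNReal.ofReal |p.1| * ENNReal.ofReal (|t| * (√(n p))⁻¹) := by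
    intro p
    rw [← ENNReal.ofReal_mul (abs_nonneg _), abs_mul, abs_mul, abs_of_nonneg (by positivity : 0 ≤ (√(n p))⁻¹)]
    congr 1; ring
  have hsm : ∀ p, (t * (√(n p))⁻¹ * p.1) • ‖toVE p‖⁻¹ • toVE p = (t * p.1 * (n p)⁻¹) • toVE p := by
    intro p
    rw [smul_smul, hnorm]
    congr 1
    have : (n p)⁻¹ = (√(n p))⁻¹ * (√(n p))⁻¹ := by
      rw [← mul_inv, Real.mul_self_sqrt (hnn p)]
    rw [this]; ring
  have hsq : ∀ p, ‖toVE p‖ ^ 2 = n p := toVE_norm_sq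
  have eA : ∀ p, ENNReal.ofReal |⟪t • e0, ‖toVE p‖⁻¹ • toVE p⟫| *
      g (⟪t • e0, ‖toVE p‖⁻¹ • toVE p⟫ • ‖toVE p‖⁻¹ • toVE p) *
      ENNReal.ofReal (Real.exp (-‖toVE p‖ ^ 2 / 2)) = ENNReal.ofReal |p.1| * ΦA p := by
    intro p
    rw [hin, habs, hsm, hsq]
    simp only [ΦA, W]; ring
  have eB : ∀ p, ENNReal.ofReal |⟪t • e0, ‖toVE p‖⁻¹ • toVE p⟫| *
      g (t • e0 - ⟪t • e0, ‖toVE p‖⁻¹ • toVE p⟫ • ‖toVE p‖⁻¹ • toVE p) *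
      ENNReal.ofReal (Real.exp (-‖toVE p‖ ^ 2 / 2)) = ENNReal.ofReal |p.1| * ΦB p := by
    intro p
    rw [hin, habs, hsm, hsq]
    simp only [ΦB, W]; ring
  simp_rw [eA, eB]
  rw [cyl_lin _ hΦA, cyl_lin _ hΦB]
  refine lintegral_congr fun φ => ?_
  rw [lintegral_lintegral_swap (by fun_prop)]
  refine setLIntegral_congr_fun measurableSet_Ioi fun ρ hρ => setLIntegral_congr_fun measurableSet_Ioi fun a ha => ?_
  have hρ' : (0:ℝ) < ρ := hρ
  have ha' : (0:ℝ) < a := ha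
  have hcs := Real.cos_sq_add_sin_sq φ
  have n1 : ∀ a ρ : ℝ, n (a, ρ * cos φ, ρ * sin φ) = a ^ 2 + ρ ^ 2 := by
    intro a ρ; simp only [n]; linear_combination ρ ^ 2 * hcs
  have hne : a ^ 2 + ρ ^ 2 ≠ 0 := by positivity
  have key : ∀ σ : ℝ, σ ^ 2 = 1 → ΦB (σ * a, ρ * cos φ, ρ * sin φ) = ΦA (-σ * ρ, a * cos φ, a * sin φ) := by
    intro σ hσ
    simp only [ΦA, ΦB, n1]
    have e : (σ * a) ^ 2 + ρ ^ 2 = a ^ 2 + ρ ^ 2 := by linear_combination a ^ 2 * hσ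
    have e' : (-σ * ρ) ^ 2 + a ^ 2 = a ^ 2 + ρ ^ 2 := by linear_combination ρ ^ 2 * hσ
    rw [e, e']
    congr 2
    rw [toVE_apply, toVE_apply]
    ext i
    fin_cases i
    · simp [e0]; field_simp; linear_combination (-t * (a ^ 2 + ρ ^ 2)) * hσ
    · simp [e0]; field_simp
    · simp [e0]; field_simp
  have k1 := key 1 (by norm_num)
  have k2 := key (-1) (by norm_num)
  simp only [one_mul, neg_mul, neg_neg] at k1 k2
  simp only [k1, k2]
  ring

lemma sphB_lin (z : V) (g : V → ENNReal) (hg : Measurable g) :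
    ∫⁻ ω : S2, ENNReal.ofReal |⟪z, (ω : V)⟫| * g (⟪z, (ω : V)⟫ • (ω : V)) ∂sphμ =
    ∫⁻ ω : S2, ENNReal.ofReal |⟪z, (ω : V)⟫| * g (z - ⟪z, (ω : V)⟫ • (ω : V)) ∂sphμ := by
  obtain ⟨R, hR⟩ := exists_rot (‖z‖ • e0) z (by rw [norm_smul, norm_e0]; simp)
  have hRm : Measurable R := R.continuous.measurable
  have h := sphB_e0 ‖z‖ (fun x => g (R x)) (hg.comp hRm)
  have hA := sph_lin_rot (fun x => ENNReal.ofReal |⟪z, x⟫| * g (⟪z, x⟫ • x)) (by fun_prop) R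
  have hB := sph_lin_rot (fun x => ENNReal.ofReal |⟪z, x⟫| * g (z - ⟪z, x⟫ • x)) (by fun_prop) R
  rw [← hA, ← hB]
  have hi : ∀ x, ⟪z, R x⟫ = ⟪‖z‖ • e0, x⟫ := fun x => by
    conv_lhs => rw [← hR]
    rw [R.inner_map_map]
  simp only [hi]
  simp only [map_sub, map_smul] at h
  rw [map_smul] at hR
  rw [hR] at h
  exact h

lemma sphB (z : V) (g : V → ℝ) (hg : Measurable g) :
    ∫ ω : S2, |⟪z, (ω : V)⟫| * g (⟪z, (ω : V)⟫ • (ω : V)) ∂sphμ =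
    ∫ ω : S2, |⟪z, (ω : V)⟫| * g (z - ⟪z, (ω : V)⟫ • (ω : V)) ∂sphμ := by
  let d : S2 → NNReal := fun ω => Real.toNNReal |⟪z, (ω : V)⟫|
  have hd : Measurable d := by fun_prop
  let ν := sphμ.withDensity (fun ω => (d ω : ENNReal))
  let a : S2 → V := fun ω => ⟪z, (ω : V)⟫ • (ω : V)
  let b : S2 → V := fun ω => z - ⟪z, (ω : V)⟫ • (ω : V)
  have ham : Measurable a := by fun_prop
  have hbm : Measurable b := by fun_prop
  have hmap : ν.map a = ν.map b := by
    refine Measure.ext_of_lintegral _ fun F hF => ?_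
    rw [lintegral_map hF ham, lintegral_map hF hbm]
    have := sphB_lin z F hF
    have hd' : Measurable (fun ω => (d ω : ENNReal)) := by fun_prop
    exact (lintegral_withDensity_eq_lintegral_mul _ hd' (hF.comp ham)).trans
      (this.trans (lintegral_withDensity_eq_lintegral_mul _ hd' (hF.comp hbm)).symm)
  have h : ∀ c : S2 → V, Measurable c → ∫ x, g x ∂(ν.map c) = ∫ ω, |⟪z, (ω : V)⟫| * g (c ω) ∂sphμ := by
    intro c hc
    rw [integral_map hc.aemeasurable hg.aestronglyMeasurable]
    rw [integral_withDensity_eq_integral_smul hd]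
    refine integral_congr_ae (Filter.Eventually.of_forall fun ω => ?_)
    simp [d, NNReal.smul_def]
  rw [← h a ham, ← h b hbm, hmap]

/-! ### Maxwellian facts and integrability -/

def κ : ℝ := (2 * π) ^ (-(3:ℝ)/2)

lemma κ_pos : 0 < κ := by unfold κ; positivity

lemma gaussM_pos (v : V) : 0 < gaussM v := by unfold gaussM; positivity

lemma gaussM_eq (v : V) : gaussM v = κ * Real.exp (-‖v‖ ^ 2 / 2) := rfl

lemma sqrt_gg (a b : V) : √(gaussM a * gaussM b) = κ * Real.exp (-(‖a‖ ^ 2 + ‖b‖ ^ 2) / 4) := by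
  rw [Real.sqrt_eq_iff_mul_self_eq (mul_pos (gaussM_pos a) (gaussM_pos b)).le
    (mul_pos κ_pos (Real.exp_pos _)).le, gaussM_eq, gaussM_eq]
  have : Real.exp (-‖a‖ ^ 2 / 2) * Real.exp (-‖b‖ ^ 2 / 2) =
      Real.exp (-(‖a‖ ^ 2 + ‖b‖ ^ 2) / 4) * Real.exp (-(‖a‖ ^ 2 + ‖b‖ ^ 2) / 4) := by
    rw [← Real.exp_add, ← Real.exp_add]; congr 1; ring
  linear_combination (κ ^ 2) * this

lemma sqrt_gg_le (a b : V) : √(gaussM a * gaussM b) ≤ κ * Real.exp (-‖a‖ ^ 2 / 4) := by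
  rw [sqrt_gg]
  have := κ_pos
  gcongr
  nlinarith [sq_nonneg ‖b‖]

lemma gaussM_le (a : V) : gaussM a ≤ κ * Real.exp (-‖a‖ ^ 2 / 4) := by
  rw [gaussM_eq]
  have := κ_pos
  gcongr _ * Real.exp ?_
  nlinarith [sq_nonneg ‖a‖]

lemma measurable_gaussM : Measurable gaussM := by unfold gaussM; fun_prop

lemma energy (v u : V) (ω : S2) :
    ‖uPrime v u ω‖ ^ 2 + ‖vPrime v u ω‖ ^ 2 = ‖u‖ ^ 2 + ‖v‖ ^ 2 := by
  have hω : ‖(ω : V)‖ = 1 := norm_eq_of_mem_sphere ω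
  unfold uPrime vPrime
  rw [norm_add_sq_real, norm_sub_sq_real, real_inner_smul_right, real_inner_smul_right, norm_smul, hω,
    inner_sub_left, Real.norm_eq_abs, mul_one, sq_abs]
  ring

lemma sqrt_energy (v u : V) (ω : S2) :
    √(gaussM (uPrime v u ω)) * √(gaussM (vPrime v u ω)) = √(gaussM u) * √(gaussM v) := by
  rw [← Real.sqrt_mul (gaussM_pos _).le, ← Real.sqrt_mul (gaussM_pos _).le, sqrt_gg, sqrt_gg, energy]

lemma int_radial (A : ℝ) (b : ℝ) (hb : 0 < b) :
    Integrable (fun u : V => (A + ‖u‖) * Real.exp (-b * ‖u‖ ^ 2)) := by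
  have := (integrable_fun_norm_addHaar (volume : Measure V) (f := fun r : ℝ => (A + r) * Real.exp (-b * r ^ 2))).2
  refine this ?_
  rw [finrankV]
  have h2 := ((integrable_rpow_mul_exp_neg_mul_sq hb (s := 2) (by norm_num)).const_mul A).add
    (integrable_rpow_mul_exp_neg_mul_sq hb (s := 3) (by norm_num))
  refine (h2.integrableOn (s := Set.Ioi (0:ℝ))).congr_fun (fun r hr => ?_) measurableSet_Ioi
  have e2 : r ^ (2:ℝ) = r ^ 2 := by norm_cast
  have e3 : r ^ (3:ℝ) = r ^ 3 := by norm_cast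
  simp only [Pi.add_apply, e2, e3, smul_eq_mul]
  ring

lemma int_inv (b : ℝ) (hb : 0 < b) :
    Integrable (fun u : V => ‖u‖⁻¹ * Real.exp (-b * ‖u‖ ^ 2)) := by
  have := (integrable_fun_norm_addHaar (volume : Measure V) (f := fun r : ℝ => r⁻¹ * Real.exp (-b * r ^ 2))).2
  refine this ?_
  rw [finrankV]
  have h2 := (integrable_rpow_mul_exp_neg_mul_sq hb (s := 1) (by norm_num))
  refine (h2.integrableOn (s := Set.Ioi (0:ℝ))).congr_fun (fun r hr => ?_) measurableSet_Ioi
  have hr' : (0:ℝ) < r := hr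
  simp only [Real.rpow_one, smul_eq_mul]
  field_simp

lemma int_dom (v : V) : Integrable (fun u : V => ‖v - u‖ * Real.exp (-‖u‖ ^ 2 / 4)) := by
  refine (int_radial ‖v‖ (1/4) (by norm_num)).mono' (by fun_prop) (Filter.Eventually.of_forall fun u => ?_)
  rw [Real.norm_of_nonneg (by positivity)]
  have : -‖u‖ ^ 2 / 4 = -(1/4) * ‖u‖ ^ 2 := by ring
  rw [this]
  gcongr
  exact norm_sub_le _ _

lemma prod_dom (v : V) (G : V × S2 → ℝ) (hG : Measurable G) (C : ℝ)
    (h : ∀ p, |G p| ≤ C * (‖v - p.1‖ * Real.exp (-‖p.1‖ ^ 2 / 4))) :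
    Integrable G (volume.prod sphμ) := by
  have := ((int_dom v).const_mul C).comp_fst sphμ
  exact this.mono' hG.aestronglyMeasurable (Filter.Eventually.of_forall h)

lemma abs_inner_le (z : V) (ω : S2) : |⟪z, (ω : V)⟫| ≤ ‖z‖ := by
  have := abs_real_inner_le_norm z (ω : V)
  rwa [norm_eq_of_mem_sphere, mul_one] at this

def T1 (f : V → ℝ) (v : V) (p : V × S2) : ℝ :=
  |⟪v - p.1, (p.2 : V)⟫| * Real.sqrt (gaussM p.1 * gaussM (uPrime v p.1 p.2)) * f (vPrime v p.1 p.2)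

def T2 (f : V → ℝ) (v : V) (p : V × S2) : ℝ :=
  |⟪v - p.1, (p.2 : V)⟫| * Real.sqrt (gaussM p.1 * gaussM (vPrime v p.1 p.2)) * f (uPrime v p.1 p.2)

lemma meas_vPrime (v : V) : Measurable (fun p : V × S2 => vPrime v p.1 p.2) := by
  unfold vPrime; fun_prop

lemma meas_uPrime (v : V) : Measurable (fun p : V × S2 => uPrime v p.1 p.2) := by
  unfold uPrime; fun_prop

lemma meas_T1 (f : V → ℝ) (hf : Measurable f) (v : V) : Measurable (T1 f v) := by
  have := meas_vPrime v
  have := meas_uPrime v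
  have := measurable_gaussM
  unfold T1; fun_prop

lemma meas_T2 (f : V → ℝ) (hf : Measurable f) (v : V) : Measurable (T2 f v) := by
  have := meas_vPrime v
  have := meas_uPrime v
  have := measurable_gaussM
  unfold T2; fun_prop

lemma bound_aux (v u x : V) (ω : S2) (y M : ℝ) (hy : |y| ≤ M) :
    |(|⟪v - u, (ω : V)⟫| * √(gaussM u * gaussM x) * y)| ≤
      (κ * M) * (‖v - u‖ * Real.exp (-‖u‖ ^ 2 / 4)) := by
  rw [abs_mul, abs_mul, abs_abs, abs_of_nonneg (Real.sqrt_nonneg _)]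
  have h1 := abs_inner_le (v - u) ω
  have h2 := sqrt_gg_le u x
  have := κ_pos
  calc _ ≤ ‖v - u‖ * (κ * Real.exp (-‖u‖ ^ 2 / 4)) * M := by gcongr
    _ = _ := by ring

lemma int_T1 (f : V → ℝ) (hf : Measurable f) (M : ℝ) (hM : ∀ v, |f v| ≤ M) (v : V) :
    Integrable (T1 f v) (volume.prod sphμ) :=
  prod_dom v _ (meas_T1 f hf v) (κ * M) fun p => bound_aux v p.1 _ p.2 _ M (hM _)

lemma int_T2 (f : V → ℝ) (hf : Measurable f) (M : ℝ) (hM : ∀ v, |f v| ≤ M) (v : V) :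
    Integrable (T2 f v) (volume.prod sphμ) :=
  prod_dom v _ (meas_T2 f hf v) (κ * M) fun p => bound_aux v p.1 _ p.2 _ M (hM _)

lemma int_D (v : V) : Integrable (fun p : V × S2 => |⟪v - p.1, (p.2 : V)⟫| * gaussM p.1) (volume.prod sphμ) := by
  have := measurable_gaussM
  refine prod_dom v _ (by fun_prop) κ fun p => ?_
  rw [abs_mul, abs_abs, abs_of_pos (gaussM_pos _)]
  have h1 := abs_inner_le (v - p.1) p.2
  have h2 := gaussM_le p.1
  have := gaussM_pos p.1
  calc _ ≤ ‖v - p.1‖ * (κ * Real.exp (-‖p.1‖ ^ 2 / 4)) := by gcongr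
    _ = _ := by ring

lemma int_D1 (f : V → ℝ) (hf : Measurable f) (M : ℝ) (hM : ∀ v, |f v| ≤ M) (v : V) :
    Integrable (fun p : V × S2 => |⟪v - p.1, (p.2 : V)⟫| * √(gaussM p.1 * gaussM v) * f p.1) (volume.prod sphμ) := by
  have := measurable_gaussM
  exact prod_dom v _ (by fun_prop) (κ * M) fun p => bound_aux v p.1 _ p.2 _ M (hM _)

lemma Q1_eq (f : V → ℝ) (hf : Measurable f) (M : ℝ) (hM : ∀ v, |f v| ≤ M) (v : V) :
    Qop gaussM (fun u => √(gaussM u) * f u) v =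
      √(gaussM v) * ((∫ u, ∫ ω, T1 f v (u, ω) ∂sphμ) - collFreq v * f v) := by
  have h1 := int_T1 f hf M hM v
  have h2 := (int_D v).mul_const (f v)
  have e : ∀ (u : V) (ω : S2), |⟪v - u, (ω : V)⟫| * (gaussM (uPrime v u ω) * (√(gaussM (vPrime v u ω)) * f (vPrime v u ω))
      - gaussM u * (√(gaussM v) * f v)) =
      √(gaussM v) * (T1 f v (u, ω) - |⟪v - u, (ω : V)⟫| * gaussM u * f v) := by
    intro u ω
    simp only [T1]
    rw [Real.sqrt_mul (gaussM_pos _).le]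
    have := sqrt_energy v u ω
    have h3 := Real.mul_self_sqrt (gaussM_pos (uPrime v u ω)).le
    linear_combination |⟪v - u, (ω : V)⟫| * f (vPrime v u ω) * √(gaussM (uPrime v u ω)) * this
      - |⟪v - u, (ω : V)⟫| * f (vPrime v u ω) * √(gaussM (vPrime v u ω)) * h3
  unfold Qop
  simp_rw [e, integral_const_mul]
  congr 1
  have h3 := integral_prod _ (h1.sub h2)
  simp only [Pi.sub_apply] at h3
  rw [← h3]
  have h4 := integral_sub h1 h2
  rw [h4, integral_prod _ h1, integral_prod _ h2]
  congr 1
  unfold collFreq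
  simp_rw [integral_mul_const]

lemma Q2_eq (f : V → ℝ) (hf : Measurable f) (M : ℝ) (hM : ∀ v, |f v| ≤ M) (v : V) :
    Qop (fun u => √(gaussM u) * f u) gaussM v =
      √(gaussM v) * ((∫ u, ∫ ω, T2 f v (u, ω) ∂sphμ) - K1op f v) := by
  have h1 := int_T2 f hf M hM v
  have h2 := int_D1 f hf M hM v
  have e : ∀ (u : V) (ω : S2), |⟪v - u, (ω : V)⟫| * (√(gaussM (uPrime v u ω)) * f (uPrime v u ω) * gaussM (vPrime v u ω)
      - √(gaussM u) * f u * gaussM v) =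
      √(gaussM v) * (T2 f v (u, ω) - |⟪v - u, (ω : V)⟫| * √(gaussM u * gaussM v) * f u) := by
    intro u ω
    simp only [T2]
    rw [Real.sqrt_mul (gaussM_pos _).le, Real.sqrt_mul (gaussM_pos _).le]
    have := sqrt_energy v u ω
    have h3 := Real.mul_self_sqrt (gaussM_pos (vPrime v u ω)).le
    have h4 := Real.mul_self_sqrt (gaussM_pos v).le
    linear_combination |⟪v - u, (ω : V)⟫| * f (uPrime v u ω) * √(gaussM (vPrime v u ω)) * this
      - |⟪v - u, (ω : V)⟫| * f (uPrime v u ω) * √(gaussM (uPrime v u ω)) * h3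
      + |⟪v - u, (ω : V)⟫| * f u * √(gaussM u) * h4
  unfold Qop
  simp_rw [e, integral_const_mul]
  congr 1
  have h3 := integral_prod _ (h1.sub h2)
  simp only [Pi.sub_apply] at h3
  rw [← h3]
  have h4 := integral_sub h1 h2
  rw [h4, integral_prod _ h1, integral_prod _ h2]
  congr 1
  unfold K1op
  simp_rw [integral_mul_const]
  simp_rw [mul_comm (gaussM v)]

lemma L_eq (f : V → ℝ) (hf : Measurable f) (M : ℝ) (hM : ∀ v, |f v| ≤ M) (v : V) :
    Lop f v = collFreq v * f v - Kop f v := by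
  have hs : 0 < √(gaussM v) := Real.sqrt_pos.2 (gaussM_pos v)
  unfold Lop
  rw [Q1_eq f hf M hM, Q2_eq f hf M hM]
  have : Kop f v = (∫ u, ∫ ω, T1 f v (u, ω) ∂sphμ) + (∫ u, ∫ ω, T2 f v (u, ω) ∂sphμ) - K1op f v := rfl
  rw [this]
  field_simp
  ring

/-! ### The kernel of `K₂` -/

lemma T2_T1 (f : V → ℝ) (hf : Measurable f) (v u : V) :
    ∫ ω, T2 f v (u, ω) ∂sphμ = ∫ ω, T1 f v (u, ω) ∂sphμ := by
  have := measurable_gaussM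
  have h := sphB (v - u) (fun x => √(gaussM u * gaussM (v - x)) * f (u + x)) (by fun_prop)
  have e1 : ∀ x : V, v - (v - u - x) = u + x := fun x => by abel
  have e2 : ∀ x : V, u + (v - u - x) = v - x := fun x => by abel
  simp only [e1, e2, ← mul_assoc] at h
  exact h

def hω (f : V → ℝ) (v : V) (p : S2 × ℝ) : ℝ :=
  |p.2| * (κ * Real.exp (-((⟪v, (p.1 : V)⟫ + p.2) ^ 2 + ⟪v, (p.1 : V)⟫ ^ 2) / 4)) * f (v + p.2 • (p.1 : V))

lemma meas_hω (f : V → ℝ) (hf : Measurable f) (v : V) : Measurable (hω f v) := by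
  unfold hω; fun_prop

lemma int_hω (f : V → ℝ) (hf : Measurable f) (M : ℝ) (hM : ∀ v, |f v| ≤ M) (v : V) :
    Integrable (hω f v) (sphμ.prod volume) := by
  have h1 : Integrable (fun r : ℝ => (κ * M) * |r * Real.exp (-(1/8) * r ^ 2)|) := by
    have := (integrable_mul_exp_neg_mul_sq (b := 1/8) (by norm_num)).abs.const_mul (κ * M)
    exact this
  refine (h1.comp_snd sphμ).mono' (meas_hω f hf v).aestronglyMeasurable (Filter.Eventually.of_forall fun p => ?_)
  have hk := κ_pos
  have hM0 : 0 ≤ M := (abs_nonneg _).trans (hM 0)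
  simp only [hω, Real.norm_eq_abs]
  rw [abs_mul, abs_mul, abs_abs, abs_of_pos (mul_pos hk (Real.exp_pos _)), abs_mul p.2,
    abs_of_pos (Real.exp_pos _)]
  calc _ ≤ |p.2| * (κ * Real.exp (-(1/8) * p.2 ^ 2)) * M := by
        gcongr
        · nlinarith [sq_nonneg (2 * ⟪v, (p.1 : V)⟫ + p.2)]
        · exact hM _
    _ = _ := by ring

lemma T1_slice (f : V → ℝ) (v : V) (ω : S2) :
    ∫ u, T1 f v (u, ω) = 2 * π * ∫ r, hω f v (ω, r) := by
  have hn : ‖(ω : V)‖ = 1 := norm_eq_of_mem_sphere ω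
  have hn2 : ⟪(ω : V), (ω : V)⟫ = 1 := by rw [real_inner_self_eq_norm_sq, hn]; norm_num
  rw [← slice_int (fun r => hω f v (ω, r)) ω hn,
    ← integral_add_right_eq_self _ (⟪v, (ω : V)⟫ • (ω : V))]
  refine integral_congr_ae (Filter.Eventually.of_forall fun z => ?_)
  have e1 : ⟪v - (z + ⟪v, (ω : V)⟫ • (ω : V)), (ω : V)⟫ = -⟪z, (ω : V)⟫ := by
    rw [inner_sub_left, inner_add_left, real_inner_smul_left, hn2]; ring
  have e2 : vPrime v (z + ⟪v, (ω : V)⟫ • (ω : V)) ω = v + ⟪z, (ω : V)⟫ • (ω : V) := by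
    unfold vPrime; rw [e1]; simp
  have e3 : uPrime v (z + ⟪v, (ω : V)⟫ • (ω : V)) ω = z + (⟪v, (ω : V)⟫ - ⟪z, (ω : V)⟫) • (ω : V) := by
    unfold uPrime; rw [e1]; module
  have nn : ∀ c : ℝ, ‖z + c • (ω : V)‖ ^ 2 = ‖z‖ ^ 2 + 2 * c * ⟪z, (ω : V)⟫ + c ^ 2 := by
    intro c
    rw [norm_add_sq_real, real_inner_smul_right, norm_smul, hn, mul_one, Real.norm_eq_abs, sq_abs]; ring
  simp only [T1, hω]
  rw [e1, e2, e3, abs_neg, sqrt_gg, nn, nn]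
  have : Real.exp (-(‖z‖ ^ 2 + 2 * ⟪v, (ω : V)⟫ * ⟪z, (ω : V)⟫ + ⟪v, (ω : V)⟫ ^ 2 +
      (‖z‖ ^ 2 + 2 * (⟪v, (ω : V)⟫ - ⟪z, (ω : V)⟫) * ⟪z, (ω : V)⟫ + (⟪v, (ω : V)⟫ - ⟪z, (ω : V)⟫) ^ 2)) / 4) =
      Real.exp (-((⟪v, (ω : V)⟫ + ⟪z, (ω : V)⟫) ^ 2 + ⟪v, (ω : V)⟫ ^ 2) / 4) *
      Real.exp (-(‖z‖ ^ 2 - ⟪z, (ω : V)⟫ ^ 2) / 2) := by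
    rw [← Real.exp_add]; congr 1; ring
  rw [this]; ring

lemma hω_half (f : V → ℝ) (hf : Measurable f) (M : ℝ) (hM : ∀ v, |f v| ≤ M) (v : V) :
    ∫ ω, (∫ r, hω f v (ω, r)) ∂sphμ = 2 * ∫ ω, (∫ r in Set.Ioi (0:ℝ), hω f v (ω, r)) ∂sphμ := by
  have hi := int_hω f hf M hM v
  have hr : sphμ.prod (volume.restrict (Set.Ioi (0:ℝ))) = (sphμ.prod volume).restrict (Set.univ ×ˢ Set.Ioi (0:ℝ)) := by
    rw [← Measure.prod_restrict, Measure.restrict_univ]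
  have hi2 : Integrable (hω f v) (sphμ.prod (volume.restrict (Set.Ioi (0:ℝ)))) := by
    rw [hr]; exact hi.integrableOn
  have hI := hi2.integral_prod_left
  have hemb : MeasurableEmbedding (fun ω : S2 => -ω) := (Homeomorph.neg S2).measurableEmbedding
  have hI' : Integrable (fun ω : S2 => ∫ r in Set.Ioi (0:ℝ), hω f v (-ω, r)) sphμ :=
    (sph_neg_mp.integrable_comp_emb hemb).2 hI
  have hneg := sph_neg_mp.integral_comp hemb (fun ω => ∫ r in Set.Ioi (0:ℝ), hω f v (ω, r))
  have : ∀ᵐ ω ∂sphμ, (∫ r, hω f v (ω, r)) = (∫ r in Set.Ioi (0:ℝ), hω f v (ω, r)) +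
      ∫ r in Set.Ioi (0:ℝ), hω f v (-ω, r) := by
    filter_upwards [hi.prod_right_ae] with ω hω1
    rw [← integral_add_compl (measurableSet_Ioi (a := (0:ℝ))) hω1]
    congr 1
    rw [Set.compl_Ioi, ← neg_zero, ← integral_comp_neg_Ioi, neg_zero]
    refine setIntegral_congr_fun measurableSet_Ioi fun r hr => ?_
    simp only [hω, coe_neg_sphere, inner_neg_right, abs_neg, smul_neg, neg_smul]
    congr 4
    ring
  rw [integral_congr_ae this, integral_add hI hI', hneg]
  ring

def FK (f : V → ℝ) (v w : V) : ℝ :=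
  ‖w‖⁻¹ * (κ * Real.exp (-((⟪v, w⟫ / ‖w‖ + ‖w‖) ^ 2 + (⟪v, w⟫ / ‖w‖) ^ 2) / 4)) * f (v + w)

lemma int_FK (f : V → ℝ) (hf : Measurable f) (M : ℝ) (hM : ∀ v, |f v| ≤ M) (v : V) :
    Integrable (FK f v) := by
  refine ((int_inv (1/8) (by norm_num)).const_mul (κ * M)).mono'
    (by unfold FK; exact Measurable.aestronglyMeasurable (by fun_prop)) (Filter.Eventually.of_forall fun w => ?_)
  have hk := κ_pos
  have hM0 : 0 ≤ M := (abs_nonneg _).trans (hM 0)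
  simp only [FK, Real.norm_eq_abs]
  rw [abs_mul, abs_mul, abs_of_pos (mul_pos hk (Real.exp_pos _)), abs_of_nonneg (by positivity : 0 ≤ ‖w‖⁻¹)]
  calc _ ≤ ‖w‖⁻¹ * (κ * Real.exp (-(1/8) * ‖w‖ ^ 2)) * M := by
        gcongr
        · nlinarith [sq_nonneg (2 * (⟪v, w⟫ / ‖w‖) + ‖w‖)]
        · exact hM _
    _ = _ := by ring

lemma FK_polar (f : V → ℝ) (hf : Measurable f) (M : ℝ) (hM : ∀ v, |f v| ≤ M) (v : V) :
    ∫ ω, (∫ r in Set.Ioi (0:ℝ), hω f v (ω, r)) ∂sphμ = ∫ w, FK f v w := by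
  rw [polar_int _ (int_FK f hf M hM v)]
  refine integral_congr_ae (Filter.Eventually.of_forall fun ω => ?_)
  refine setIntegral_congr_fun measurableSet_Ioi fun r hr => ?_
  have hr' : (0:ℝ) < r := hr
  have : ‖r • (ω : V)‖ = r := by
    rw [norm_smul, norm_eq_of_mem_sphere, mul_one, Real.norm_of_nonneg hr'.le]
  simp only [hω, FK, this, real_inner_smul_right, abs_of_pos hr', mul_div_cancel_left₀ _ hr'.ne']
  field_simp

def k2 (v u : V) : ℝ :=
  ‖v - u‖⁻¹ * (κ * (Real.exp (-‖v - u‖ ^ 2 / 8) *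
          Real.exp (-(‖v‖ ^ 2 - ‖u‖ ^ 2) ^ 2 / (8 * ‖v - u‖ ^ 2))))

lemma FK_k2 (f : V → ℝ) (v u : V) : FK f v (u - v) = k2 v u * f u := by
  unfold FK k2
  rw [add_sub_cancel, ← norm_sub_rev u v]
  by_cases h : ‖u - v‖ = 0
  · simp [h]
  congr 3
  rw [← Real.exp_add]
  congr 1
  have e : ‖u‖ ^ 2 = ‖v‖ ^ 2 + 2 * ⟪v, u - v⟫ + ‖u - v‖ ^ 2 := by
    rw [← norm_add_sq_real, add_sub_cancel]
  rw [e]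
  field_simp
  ring

lemma int_k2 (f : V → ℝ) (hf : Measurable f) (M : ℝ) (hM : ∀ v, |f v| ≤ M) (v : V) :
    Integrable (fun u => k2 v u * f u) := by
  have := (int_FK f hf M hM v).comp_sub_right v
  simpa only [FK_k2] using this

lemma T1_k2 (f : V → ℝ) (hf : Measurable f) (M : ℝ) (hM : ∀ v, |f v| ≤ M) (v : V) :
    ∫ u, ∫ ω, T1 f v (u, ω) ∂sphμ = 4 * π * ∫ u, k2 v u * f u := by
  have h := int_T1 f hf M hM v
  rw [integral_integral_swap (f := fun u ω => T1 f v (u, ω)) h]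
  simp_rw [T1_slice, integral_const_mul]
  rw [hω_half f hf M hM, FK_polar f hf M hM, ← integral_sub_right_eq_self _ v]
  simp_rw [FK_k2]
  ring

def k1 (v u : V) : ℝ := (∫ ω : S2, |⟪v - u, (ω : V)⟫| ∂sphμ) * √(gaussM v * gaussM u)

lemma int_k1 (f : V → ℝ) (hf : Measurable f) (M : ℝ) (hM : ∀ v, |f v| ≤ M) (v : V) :
    Integrable (fun u => k1 v u * f u) := by
  have := (int_D1 f hf M hM v).integral_prod_left
  simp_rw [integral_mul_const, mul_comm (gaussM _) (gaussM v)] at this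
  exact this

lemma meas_k1 : Measurable (Function.uncurry k1) := by
  have := measurable_gaussM
  have h1 : StronglyMeasurable (fun q : V × V => ∫ ω : S2, |⟪q.1 - q.2, (ω : V)⟫| ∂sphμ) := by
    have h2 : Measurable (fun q : (V × V) × S2 => |⟪q.1.1 - q.1.2, (q.2 : V)⟫|) := by fun_prop
    exact h2.stronglyMeasurable.integral_prod_right
  have h3 := h1.measurable
  unfold k1 Function.uncurry
  fun_prop

lemma meas_k2 : Measurable (Function.uncurry k2) := by
  unfold k2 Function.uncurry
  fun_prop

lemma k1_nonneg (v u : V) : 0 ≤ k1 v u :=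
  mul_nonneg (integral_nonneg fun _ => abs_nonneg _) (Real.sqrt_nonneg _)

lemma k1_le (v u : V) (h : v ≠ u) : k1 v u ≤ κ * sphμ.real Set.univ * ‖v - u‖ *
    (Real.exp (-‖v - u‖ ^ 2 / 8) * Real.exp (-(‖v‖ ^ 2 - ‖u‖ ^ 2) ^ 2 / (8 * ‖v - u‖ ^ 2))) := by
  have hk := κ_pos
  have hN : 0 < ‖v - u‖ := norm_pos_iff.2 (sub_ne_zero.2 h)
  have h1 : (∫ ω : S2, |⟪v - u, (ω : V)⟫| ∂sphμ) ≤ ‖v - u‖ * sphμ.real Set.univ := by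
    have := norm_integral_le_of_norm_le_const (μ := sphμ) (f := fun ω : S2 => |⟪v - u, (ω : V)⟫|) (C := ‖v - u‖)
      (Filter.Eventually.of_forall fun ω => by rw [Real.norm_eq_abs, abs_abs]; exact abs_inner_le _ _)
    exact (le_abs_self _).trans this
  have h2 : √(gaussM v * gaussM u) ≤ κ * (Real.exp (-‖v - u‖ ^ 2 / 8) * Real.exp (-(‖v‖ ^ 2 - ‖u‖ ^ 2) ^ 2 / (8 * ‖v - u‖ ^ 2))) := by
    rw [sqrt_gg, ← Real.exp_add]
    gcongr
    have e1 : ⟪v - u, v + u⟫ = ‖v‖ ^ 2 - ‖u‖ ^ 2 := by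
      rw [inner_sub_left, inner_add_right, inner_add_right, real_inner_self_eq_norm_sq,
        real_inner_self_eq_norm_sq, real_inner_comm]; ring
    have e2 : (‖v‖ ^ 2 - ‖u‖ ^ 2) ^ 2 ≤ ‖v - u‖ ^ 2 * ‖v + u‖ ^ 2 := by
      rw [← e1, ← mul_pow, ← sq_abs]
      gcongr
      exact abs_real_inner_le_norm _ _
    have e3 : ‖v - u‖ ^ 2 + ‖v + u‖ ^ 2 = 2 * (‖v‖ ^ 2 + ‖u‖ ^ 2) := by
      rw [norm_sub_sq_real, norm_add_sq_real]; ring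
    have e4 : (‖v‖ ^ 2 - ‖u‖ ^ 2) ^ 2 / (8 * ‖v - u‖ ^ 2) ≤ ‖v + u‖ ^ 2 / 8 := by
      rw [div_le_div_iff₀ (by positivity) (by norm_num)]
      nlinarith
    have e5 : -(‖v‖ ^ 2 - ‖u‖ ^ 2) ^ 2 / (8 * ‖v - u‖ ^ 2) = -((‖v‖ ^ 2 - ‖u‖ ^ 2) ^ 2 / (8 * ‖v - u‖ ^ 2)) := by ring
    rw [e5]
    linarith
  calc k1 v u ≤ (‖v - u‖ * sphμ.real Set.univ) * (κ * (Real.exp (-‖v - u‖ ^ 2 / 8) * Real.exp (-(‖v‖ ^ 2 - ‖u‖ ^ 2) ^ 2 / (8 * ‖v - u‖ ^ 2)))) := by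
        unfold k1; gcongr
    _ = _ := by ring

lemma k_bound (v u : V) (h : v ≠ u) :
    |8 * π * k2 v u - k1 v u| ≤ (8 * π * κ + κ * sphμ.real Set.univ) * (‖v - u‖ + ‖v - u‖⁻¹) *
      Real.exp (-‖v - u‖ ^ 2 / 8) * Real.exp (-(‖v‖ ^ 2 - ‖u‖ ^ 2) ^ 2 / (8 * ‖v - u‖ ^ 2)) := by
  have hk := κ_pos
  have h1 := k1_le v u h
  have h0 := k1_nonneg v u
  have hσ : 0 ≤ sphμ.real Set.univ := measureReal_nonneg
  have hpi := Real.pi_pos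
  unfold k2
  set E := Real.exp (-‖v - u‖ ^ 2 / 8) * Real.exp (-(‖v‖ ^ 2 - ‖u‖ ^ 2) ^ 2 / (8 * ‖v - u‖ ^ 2)) with hE
  have hE0 : 0 < E := by positivity
  rw [mul_assoc _ (Real.exp _) (Real.exp _), ← hE]
  have a1 : 0 ≤ 8 * π * (‖v - u‖⁻¹ * (κ * E)) := by positivity
  have a2 : 0 ≤ 8 * π * κ * ‖v - u‖ * E := by positivity
  have a3 : 0 ≤ κ * sphμ.real Set.univ * ‖v - u‖⁻¹ * E := by positivity
  rw [abs_le]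
  constructor <;> nlinarith

lemma K_eq (f : V → ℝ) (hf : Measurable f) (M : ℝ) (hM : ∀ v, |f v| ≤ M) (v : V) :
    Kop f v = ∫ u, (8 * π * k2 v u - k1 v u) * f u := by
  have : Kop f v = (∫ u, ∫ ω, T1 f v (u, ω) ∂sphμ) + (∫ u, ∫ ω, T2 f v (u, ω) ∂sphμ) -
    ∫ u, k1 v u * f u := rfl
  rw [this]
  simp_rw [T2_T1 f hf]
  rw [T1_k2 f hf M hM]
  have e : ∀ u, (8 * π * k2 v u - k1 v u) * f u = 8 * π * (k2 v u * f u) - k1 v u * f u := fun u => by ring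
  simp_rw [e]
  rw [integral_sub ((int_k2 f hf M hM v).const_mul _) (int_k1 f hf M hM v), integral_const_mul]
  ring

lemma bdd_of_gauss (f : V → ℝ) (h : ∃ C a : ℝ, 0 < a ∧ ∀ v, |f v| ≤ C * Real.exp (-a * ‖v‖ ^ 2)) :
    ∃ M, ∀ v, |f v| ≤ M := by
  obtain ⟨C, a, ha, h⟩ := h
  refine ⟨|C|, fun v => (h v).trans ?_⟩
  have h1 : Real.exp (-a * ‖v‖ ^ 2) ≤ 1 := by
    rw [Real.exp_le_one_iff]
    have : 0 ≤ a * ‖v‖ ^ 2 := by positivity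
    linarith
  calc C * Real.exp (-a * ‖v‖ ^ 2) ≤ |C| * 1 := by
        gcongr
        exact le_abs_self C
    _ = |C| := mul_one _

/-- `L = ν − K`, `K` is an integral operator with kernel `k(v,u)` satisfying the
Grad estimate `|k(v,u)| ≤ C(|v−u| + |v−u|⁻¹) e^{−|v−u|²/8} e^{−(|v|²−|u|²)²/(8|v−u|²)}`. -/
theorem stmt6 :
    (∀ f : V → ℝ, Measurable f →
        (∃ C a : ℝ, 0 < a ∧ ∀ v, |f v| ≤ C * Real.exp (-a * ‖v‖ ^ 2)) →
      ∀ v, Lop f v = collFreq v * f v - Kop f v) ∧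
    ∃ k : V → V → ℝ, Measurable (Function.uncurry k) ∧
      (∀ f : V → ℝ, Measurable f →
          (∃ C a : ℝ, 0 < a ∧ ∀ v, |f v| ≤ C * Real.exp (-a * ‖v‖ ^ 2)) →
        ∀ v, Kop f v = ∫ u : V, k v u * f u) ∧
      ∃ C > (0:ℝ), ∀ v u : V, v ≠ u →
        |k v u| ≤ C * (‖v - u‖ + ‖v - u‖⁻¹) * Real.exp (-‖v - u‖ ^ 2 / 8) *
          Real.exp (-(‖v‖ ^ 2 - ‖u‖ ^ 2) ^ 2 / (8 * ‖v - u‖ ^ 2)) := by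
  refine ⟨fun f hf hb v => ?_, fun v u => 8 * π * k2 v u - k1 v u, ?_, fun f hf hb v => ?_,
    8 * π * κ + κ * sphμ.real Set.univ, ?_, k_bound⟩
  · obtain ⟨M, hM⟩ := bdd_of_gauss f hb
    exact L_eq f hf M hM v
  · exact (meas_k2.const_mul _).sub meas_k1
  · obtain ⟨M, hM⟩ := bdd_of_gauss f hb
    exact K_eq f hf M hM v
  · have hk := κ_pos
    have hσ : 0 ≤ sphμ.real Set.univ := measureReal_nonneg
    positivity

end
end
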